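/- arXiv:2008.06257 — 2 statements merged into one kernel-verified Lean document; each statement's English description precedes it below -/
import Mathlib

section
/- (1) The functor A : C*Cat^nu_inj → C*Alg^nu preserves isometric inclusions: if i : C → D is a morphism of possibly non-unital small C*-categories that is injective on objects and an isometric inclusion on morphism spaces, then A(i) : A(C) → A(D) is an isometric inclusion of C*-algebras. (2) For C in C*Cat^nu, every injective ∗-homomorphism A^alg(C) → B into a C*-algebra B extends to an isometric homomorphism A(C) → B. -/
noncomputable section

open scoped ENNReal

/-- A possibly non-unital ℂ-linear ∗-category. -/
structure StarCatNu : Type 1 where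
  Obj : Type
  Hom : Obj → Obj → Type
  [homAddCommGroup : ∀ X Y, AddCommGroup (Hom X Y)]
  [homModule : ∀ X Y, Module ℂ (Hom X Y)]
  comp : ∀ {X Y Z : Obj}, Hom Y Z → Hom X Y → Hom X Z
  star : ∀ {X Y : Obj}, Hom X Y → Hom Y X
  comp_assoc : ∀ {W X Y Z : Obj} (h : Hom Y Z) (g : Hom X Y) (f : Hom W X),
    comp (comp h g) f = comp h (comp g f)
  add_comp : ∀ {X Y Z : Obj} (g g' : Hom Y Z) (f : Hom X Y),
    comp (g + g') f = comp g f + comp g' f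
  comp_add : ∀ {X Y Z : Obj} (g : Hom Y Z) (f f' : Hom X Y),
    comp g (f + f') = comp g f + comp g f'
  smul_comp : ∀ {X Y Z : Obj} (c : ℂ) (g : Hom Y Z) (f : Hom X Y),
    comp (c • g) f = c • comp g f
  comp_smul : ∀ {X Y Z : Obj} (c : ℂ) (g : Hom Y Z) (f : Hom X Y),
    comp g (c • f) = c • comp g f
  star_star : ∀ {X Y : Obj} (f : Hom X Y), star (star f) = f
  star_comp : ∀ {X Y Z : Obj} (g : Hom Y Z) (f : Hom X Y),
    star (comp g f) = comp (star f) (star g)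
  star_add : ∀ {X Y : Obj} (f f' : Hom X Y), star (f + f') = star f + star f'
  star_smul : ∀ {X Y : Obj} (c : ℂ) (f : Hom X Y),
    star (c • f) = (starRingEnd ℂ) c • star f

attribute [instance] StarCatNu.homAddCommGroup StarCatNu.homModule

namespace StarCatNu

/-- Transport of morphisms along equalities of objects. -/
def castHom (C : StarCatNu) {X X' Y Y' : C.Obj} (hX : X = X') (hY : Y = Y')
    (f : C.Hom X Y) : C.Hom X' Y' := hX ▸ hY ▸ f

theorem comp_zero (C : StarCatNu) {X Y Z : C.Obj} (g : C.Hom Y Z) :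
    C.comp g (0 : C.Hom X Y) = 0 :=
  (AddMonoidHom.mk' (fun f : C.Hom X Y => C.comp g f) (C.comp_add g)).map_zero

theorem zero_comp (C : StarCatNu) {X Y Z : C.Obj} (f : C.Hom X Y) :
    C.comp (0 : C.Hom Y Z) f = 0 :=
  (AddMonoidHom.mk' (fun g : C.Hom Y Z => C.comp g f) (fun a b => C.add_comp a b f)).map_zero

theorem star_zero' (C : StarCatNu) {X Y : C.Obj} :
    C.star (0 : C.Hom X Y) = 0 :=
  (AddMonoidHom.mk' (fun f : C.Hom X Y => C.star f) C.star_add).map_zero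

end StarCatNu

/-- A (not necessarily unit-preserving) functor between possibly non-unital ℂ-linear
∗-categories, compatible with the enrichment and the involutions. -/
structure StarFunctor (C D : StarCatNu) where
  obj : C.Obj → D.Obj
  map : ∀ {X Y : C.Obj}, C.Hom X Y → D.Hom (obj X) (obj Y)
  map_add : ∀ (X Y : C.Obj) (f f' : C.Hom X Y), map (f + f') = map f + map f'
  map_smul : ∀ (X Y : C.Obj) (c : ℂ) (f : C.Hom X Y), map (c • f) = c • map f
  map_comp : ∀ (X Y Z : C.Obj) (g : C.Hom Y Z) (f : C.Hom X Y),
    map (C.comp g f) = D.comp (map g) (map f)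
  map_star : ∀ (X Y : C.Obj) (f : C.Hom X Y), map (C.star f) = D.star (map f)

namespace StarFunctor

theorem map_zero {C D : StarCatNu} (F : StarFunctor C D) (X Y : C.Obj) :
    F.map (0 : C.Hom X Y) = 0 :=
  (AddMonoidHom.mk' (fun f : C.Hom X Y => F.map f) (F.map_add X Y)).map_zero

/-- The identity functor. -/
def id (C : StarCatNu) : StarFunctor C C where
  obj X := X
  map f := f
  map_add _ _ _ _ := rfl
  map_smul _ _ _ _ := rfl
  map_comp _ _ _ _ _ := rfl
  map_star _ _ _ := rfl

/-- Composition of functors: first `F`, then `G`. -/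
def comp {C D E : StarCatNu} (F : StarFunctor C D) (G : StarFunctor D E) :
    StarFunctor C E where
  obj X := G.obj (F.obj X)
  map f := G.map (F.map f)
  map_add X Y f f' := by
    show G.map (F.map (f + f')) = G.map (F.map f) + G.map (F.map f')
    rw [F.map_add, G.map_add]
  map_smul X Y c f := by
    show G.map (F.map (c • f)) = c • G.map (F.map f)
    rw [F.map_smul, G.map_smul]
  map_comp X Y Z g f := by
    show G.map (F.map (C.comp g f)) = E.comp (G.map (F.map g)) (G.map (F.map f))
    rw [F.map_comp, G.map_comp]
  map_star X Y f := by
    show G.map (F.map (C.star f)) = E.star (G.map (F.map f))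
    rw [F.map_star, G.map_star]

end StarFunctor

instance : CategoryTheory.Category StarCatNu where
  Hom := StarFunctor
  id := StarFunctor.id
  comp := StarFunctor.comp
  id_comp := by intros; rfl
  comp_id := by intros; rfl
  assoc := by intros; rfl
/-- A possibly non-unital ∗-algebra over ℂ regarded as a ℂ-linear ∗-category with a
single object. -/
def StarCatNu.ofAlgebra (B : Type) [NonUnitalRing B] [Module ℂ B]
    [SMulCommClass ℂ B B] [IsScalarTower ℂ B B] [StarRing B] [StarModule ℂ B] :
    StarCatNu where
  Obj := PUnit
  Hom _ _ := B
  comp g f := g * f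
  star b := Star.star b
  comp_assoc h g f := mul_assoc h g f
  add_comp g g' f := add_mul g g' f
  comp_add g f f' := mul_add g f f'
  smul_comp c g f := smul_mul_assoc c g f
  comp_smul c g f := mul_smul_comm c g f
  star_star f := InvolutiveStar.star_involutive f
  star_comp g f := StarMul.star_mul g f
  star_add f f' := StarAddMonoid.star_add f f'
  star_smul c f := by
    show Star.star (c • f) = (starRingEnd ℂ) c • Star.star f
    rw [StarModule.star_smul, starRingEnd_apply]

/-- The maximal semi-norm of a morphism in a possibly non-unital ℂ-linear ∗-category:
the supremum of `‖ρ f‖` over all morphisms `ρ` into C*-algebras regarded as one-object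
ℂ-linear ∗-categories. -/
noncomputable def StarCatNu.repNorm (C : StarCatNu) {X Y : C.Obj} (f : C.Hom X Y)
    (B : Type) [NonUnitalCStarAlgebra B] (ρ : StarFunctor C (StarCatNu.ofAlgebra B)) : ℝ≥0∞ :=
  (‖id (α := B) (ρ.map f)‖₊ : ℝ≥0∞)

noncomputable def StarCatNu.maxNorm (C : StarCatNu) {X Y : C.Obj} (f : C.Hom X Y) : ℝ≥0∞ :=
  sSup { r : ℝ≥0∞ | ∃ (B : Type) (i : NonUnitalCStarAlgebra B)
    (ρ : StarFunctor C (StarCatNu.ofAlgebra B)), r = @StarCatNu.repNorm C X Y f B i ρ }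

/-- A pre-C*-category: all morphisms have finite maximal semi-norm. -/
def IsPreCStar (C : StarCatNu) : Prop :=
  ∀ (X Y : C.Obj) (f : C.Hom X Y), C.maxNorm f < ⊤

/-- A C*-category: the maximal semi-norm is a finite norm and the morphism spaces are
complete with respect to it (completeness is expressed via Cauchy sequences). -/
def IsCStar (C : StarCatNu) : Prop :=
  IsPreCStar C ∧
  (∀ (X Y : C.Obj) (f : C.Hom X Y), C.maxNorm f = 0 → f = 0) ∧
  (∀ (X Y : C.Obj) (u : ℕ → C.Hom X Y),
    (∀ ε : ℝ≥0∞, 0 < ε → ∃ N, ∀ m ≥ N, ∀ n ≥ N, C.maxNorm (u m - u n) < ε) →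
    ∃ f : C.Hom X Y, ∀ ε : ℝ≥0∞, 0 < ε → ∃ N, ∀ n ≥ N, C.maxNorm (u n - f) < ε)

/-- `e` is an identity morphism at its object. -/
def IsIdentityAt (C : StarCatNu) {X : C.Obj} (e : C.Hom X X) : Prop :=
  (∀ (Y : C.Obj) (f : C.Hom X Y), C.comp f e = f) ∧
  (∀ (Y : C.Obj) (g : C.Hom Y X), C.comp e g = g)

/-- A ℂ-linear ∗-category is unital if every object admits an identity morphism. -/
def StarCatNu.IsUnital (C : StarCatNu) : Prop :=
  ∀ X : C.Obj, ∃ e : C.Hom X X, IsIdentityAt C e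

/-- A functor is unital if it sends identity morphisms to identity morphisms. -/
def StarFunctor.Unital {C D : StarCatNu} (F : StarFunctor C D) : Prop :=
  ∀ (X : C.Obj) (e : C.Hom X X), IsIdentityAt C e → IsIdentityAt D (F.map e)

/-- A morphism `u` is unitary if `u* ∘ u` and `u ∘ u*` are identity morphisms. -/
def IsUnitary (D : StarCatNu) {A B : D.Obj} (u : D.Hom A B) : Prop :=
  IsIdentityAt D (D.comp (D.star u) u) ∧ IsIdentityAt D (D.comp u (D.star u))

/-- A unitary natural transformation between two functors. -/
structure UnitaryTrans {C D : StarCatNu} (F G : StarFunctor C D) where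
  app : ∀ X : C.Obj, D.Hom (F.obj X) (G.obj X)
  natural : ∀ (X Y : C.Obj) (f : C.Hom X Y),
    D.comp (app Y) (F.map f) = D.comp (G.map f) (app X)
  unitary : ∀ X : C.Obj, IsUnitary D (app X)

/-- A functor is a unitary equivalence if it is invertible up to unitary isomorphism. -/
def IsUnitaryEquiv {C D : StarCatNu} (F : StarFunctor C D) : Prop :=
  ∃ H : StarFunctor D C,
    Nonempty (UnitaryTrans (F.comp H) (StarFunctor.id C)) ∧
    Nonempty (UnitaryTrans (H.comp F) (StarFunctor.id D))

/-- A quotient morphism: bijective on objects and surjective on all morphism spaces. -/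
def IsQuotientHom {C D : StarCatNu} (F : StarFunctor C D) : Prop :=
  Function.Bijective F.obj ∧
  ∀ (X Y : C.Obj), Function.Surjective (fun f : C.Hom X Y => F.map f)

/-- An exact sequence `0 → C → D → Q → 0`: `p` is a quotient morphism and `i` is the
inclusion of its kernel. -/
structure IsExactSeq {C D Q : StarCatNu} (i : StarFunctor C D) (p : StarFunctor D Q) : Prop where
  i_obj_bij : Function.Bijective i.obj
  i_map_inj : ∀ (X Y : C.Obj), Function.Injective (fun f : C.Hom X Y => i.map f)
  p_quot : IsQuotientHom p
  exact : ∀ (X Y : C.Obj) (f : D.Hom (i.obj X) (i.obj Y)),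
    p.map f = 0 ↔ ∃ g : C.Hom X Y, i.map g = f

/-- `ι : C → Cc` exhibits the C*-category `Cc` as the completion of the pre-C*-category `C`
with respect to the maximal semi-norm. -/
structure IsCompletion (C Cc : StarCatNu) (ι : StarFunctor C Cc) : Prop where
  pre : IsPreCStar C
  cstar : IsCStar Cc
  obj_bij : Function.Bijective ι.obj
  isometric : ∀ (X Y : C.Obj) (f : C.Hom X Y), Cc.maxNorm (ι.map f) = C.maxNorm f
  dense : ∀ (X Y : C.Obj) (h : Cc.Hom (ι.obj X) (ι.obj Y)) (ε : ℝ≥0∞), 0 < ε →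
    ∃ f : C.Hom X Y, Cc.maxNorm (h - ι.map f) < ε

/-- The maximal semi-norm of an element of a possibly non-unital ∗-algebra over ℂ:
the supremum of `‖φ x‖` over all ∗-homomorphisms `φ` into C*-algebras. -/
noncomputable def algRepNorm (R : Type) [NonUnitalRing R] [Module ℂ R]
    [SMulCommClass ℂ R R] [IsScalarTower ℂ R R] [StarRing R] [StarModule ℂ R]
    (x : R) (B : Type) [NonUnitalCStarAlgebra B] (φ : R →⋆ₙₐ[ℂ] B) : ℝ≥0∞ :=
  (‖φ x‖₊ : ℝ≥0∞)

/-- The maximal semi-norm on a ∗-algebra over ℂ. -/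
noncomputable def algMaxNorm (R : Type) [NonUnitalRing R] [Module ℂ R]
    [SMulCommClass ℂ R R] [IsScalarTower ℂ R R] [StarRing R] [StarModule ℂ R]
    (x : R) : ℝ≥0∞ :=
  sSup { r : ℝ≥0∞ | ∃ (B : Type) (i : NonUnitalCStarAlgebra B) (φ : R →⋆ₙₐ[ℂ] B),
    r = @algRepNorm R _ _ _ _ _ _ x B i φ }

/-- A ∗-algebra over ℂ is a pre-C*-algebra if all its elements have finite maximal
semi-norm. -/
def IsPreCStarAlg (R : Type) [NonUnitalRing R] [Module ℂ R]
    [SMulCommClass ℂ R R] [IsScalarTower ℂ R R] [StarRing R] [StarModule ℂ R] : Prop :=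
  ∀ x : R, algMaxNorm R x < ⊤

/-- `j : R → R̄` exhibits the C*-algebra `R̄` as the completion of the pre-C*-algebra `R`
with respect to the maximal semi-norm. -/
structure IsAlgCompletion (R : Type) [NonUnitalRing R] [Module ℂ R]
    [SMulCommClass ℂ R R] [IsScalarTower ℂ R R] [StarRing R] [StarModule ℂ R]
    (R' : Type) [NonUnitalCStarAlgebra R'] (j : R →⋆ₙₐ[ℂ] R') : Prop where
  isometric : ∀ x : R, (‖j x‖₊ : ℝ≥0∞) = algMaxNorm R x
  dense : DenseRange j

/-- `A`, together with the family `ι` (sending a morphism `f` to the element `[f]`), is a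
realization of the ∗-algebra `A^alg(C)`: the direct sum `⊕_{X,Y ∈ Ob(C)} Hom_C(X, Y)`,
with product `[g][f] = [g ∘ f]` when the morphisms are composable and `0` otherwise, and
involution `[f]* = [f*]`. -/
structure IsAAlg (C : StarCatNu) (A : Type) [NonUnitalRing A] [Module ℂ A]
    [SMulCommClass ℂ A A] [IsScalarTower ℂ A A] [StarRing A] [StarModule ℂ A] where
  ι : ∀ {X Y : C.Obj}, C.Hom X Y → A
  ι_add : ∀ (X Y : C.Obj) (f f' : C.Hom X Y), ι (f + f') = ι f + ι f'
  ι_smul : ∀ (X Y : C.Obj) (c : ℂ) (f : C.Hom X Y), ι (c • f) = c • ι f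
  ι_mul_comp : ∀ (X Y Z : C.Obj) (g : C.Hom Y Z) (f : C.Hom X Y),
    ι g * ι f = ι (C.comp g f)
  ι_mul_ne : ∀ (X Y X' Y' : C.Obj) (g : C.Hom X' Y') (f : C.Hom X Y),
    Y ≠ X' → ι g * ι f = 0
  ι_star : ∀ (X Y : C.Obj) (f : C.Hom X Y), star (ι f) = ι (C.star f)
  span : ∀ a : A, ∃ (s : Finset (C.Obj × C.Obj)) (φ : ∀ p : C.Obj × C.Obj, C.Hom p.1 p.2),
    a = s.sum fun p => ι (φ p)
  indep : ∀ (s : Finset (C.Obj × C.Obj)) (φ : ∀ p : C.Obj × C.Obj, C.Hom p.1 p.2),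
    (s.sum fun p => ι (φ p)) = 0 → ∀ p ∈ s, φ p = 0

/-- A function on a C*-algebra that restricts to a star homomorphism on a closed
star-subalgebra is contractive there. -/
theorem contract_aux {E B : Type*} [NonUnitalCStarAlgebra E] [NonUnitalCStarAlgebra B]
    (R : NonUnitalStarSubalgebra ℂ E) (hR : IsClosed (R : Set E)) (h : E → B)
    (hadd : ∀ x ∈ R, ∀ y ∈ R, h (x + y) = h x + h y)
    (hmul : ∀ x ∈ R, ∀ y ∈ R, h (x * y) = h x * h y)
    (hsmul : ∀ (c : ℂ), ∀ x ∈ R, h (c • x) = c • h x)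
    (hstar : ∀ x ∈ R, h (star x) = star (h x)) :
    (∀ x ∈ R, ‖h x‖ ≤ ‖x‖) ∧ (Set.InjOn h R → ∀ x ∈ R, ‖h x‖ = ‖x‖) := by
  have : IsClosed (R : Set E) := hR
  let χ : R →⋆ₙₐ[ℂ] B :=
    { toFun := fun r => h r
      map_smul' := fun c r => hsmul c r r.2
      map_zero' := by simpa using hsmul 0 0 R.zero_mem
      map_add' := fun x y => hadd x x.2 y y.2
      map_mul' := fun x y => hmul x x.2 y y.2
      map_star' := fun x => hstar x x.2 }
  constructor
  · intro x hx
    exact NonUnitalStarAlgHom.norm_apply_le χ ⟨x, hx⟩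
  · intro hinj x hx
    refine NonUnitalStarAlgHom.norm_map χ ?_ ⟨x, hx⟩
    intro a b hab
    exact Subtype.ext (hinj a.2 b.2 hab)

open scoped ComplexOrder in
/-- Positive functionals separate points from zero. -/
theorem exists_posfunctional {A : Type*} [NonUnitalCStarAlgebra A] [PartialOrder A]
    [StarOrderedRing A] (a : A) (ha : 0 ≤ a) (ha0 : a ≠ 0) :
    ∃ f : A →ₚ[ℂ] ℂ, f a ≠ 0 := by
  let K : ProperCone ℝ A :=
    { carrier := {x | 0 ≤ x}
      add_mem' := fun hx hy => add_nonneg hx hy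
      zero_mem' := le_refl (0 : A)
      smul_mem' := by
        intro c x hx
        exact smul_nonneg c.2 hx
      isClosed' := CStarAlgebra.isClosed_nonneg }
  have hK : -a ∉ K := by
    intro h
    have h' : 0 ≤ -a := h
    exact ha0 (le_antisymm (by simpa using h') ha)
  obtain ⟨f, hf, hfa⟩ := K.hyperplane_separation_point hK
  let g : A →ₗ[ℝ] ℝ :=
    { toFun := fun x => f x + f (star x)
      map_add' := by intro x y; simp; ring
      map_smul' := by intro c x; simp [star_smul]; ring }
  have hg : ∀ x : A, IsSelfAdjoint x → g (Complex.I • x) = 0 := by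
    intro x hx
    show f (Complex.I • x) + f (star (Complex.I • x)) = 0
    rw [star_smul, hx.star_eq]
    simp
  let F : A →ₗ[ℂ] ℂ := Module.Dual.extendRCLike (𝕜 := ℂ) g
  have hF : ∀ x : A, IsSelfAdjoint x → F x = ((g x : ℝ) : ℂ) := by
    intro x hx
    have := Module.Dual.extendRCLike_apply (𝕜 := ℂ) g x
    rw [show F x = _ from this]
    have h2 := hg x hx
    simp [h2]
  refine ⟨PositiveLinearMap.mk₀ F ?_, ?_⟩
  · intro x hx
    rw [hF x (IsSelfAdjoint.of_nonneg hx)]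
    have h1 := hf x hx
    have : 0 ≤ g x := by
      show 0 ≤ f x + f (star x)
      rw [(IsSelfAdjoint.of_nonneg hx).star_eq]; linarith
    exact_mod_cast this
  · show F a ≠ 0
    rw [hF a (IsSelfAdjoint.of_nonneg ha)]
    have : 0 < g a := by
      show 0 < f a + f (star a)
      rw [(IsSelfAdjoint.of_nonneg ha).star_eq]
      have : f (-a) = - f a := map_neg f a
      linarith
    exact_mod_cast this.ne'

open scoped ComplexOrder in
/-- Every nonzero element of a C*-algebra is detected by a representation on a Hilbert space. -/
theorem exists_hilbert_rep {A : Type} [NonUnitalCStarAlgebra A] (b : A) (hb : b ≠ 0) :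
    ∃ (H : Type) (_ : NormedAddCommGroup H) (_ : InnerProductSpace ℂ H) (_ : CompleteSpace H)
      (π : A →⋆ₙₐ[ℂ] (H →L[ℂ] H)), π b ≠ 0 := by
  let := CStarAlgebra.spectralOrder A
  have := CStarAlgebra.spectralOrderedRing A
  have hbb : b * star b ≠ 0 := fun h => hb (CStarRing.mul_star_self_eq_zero_iff b |>.1 h)
  have h2 : star (b * star b) * (b * star b) ≠ 0 := fun h =>
    hbb (CStarRing.star_mul_self_eq_zero_iff _ |>.1 h)
  obtain ⟨f, hf⟩ := exists_posfunctional _ (star_mul_self_nonneg (b * star b)) h2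
  refine ⟨f.GNS, inferInstance, inferInstance, inferInstance, f.gnsNonUnitalStarAlgHom, ?_⟩
  intro h0
  have h3 : f.gnsNonUnitalStarAlgHom b ((f.toPreGNS (star b) : f.PreGNS) : f.GNS) = 0 := by
    rw [h0]; rfl
  rw [PositiveLinearMap.gnsNonUnitalStarAlgHom_apply_coe] at h3
  have h4 : ‖f.leftMulMapPreGNS b (f.toPreGNS (star b))‖ = 0 := by
    rw [← UniformSpace.Completion.norm_coe, h3, norm_zero]
  have h5 := f.preGNS_norm_sq (f.leftMulMapPreGNS b (f.toPreGNS (star b)))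
  rw [h4] at h5
  apply hf
  simpa using h5.symm

universe uB

/-- A representation of a star-category in a C*-algebra (of arbitrary universe level). -/
structure CRep (C : StarCatNu) (B : Type uB) [NonUnitalCStarAlgebra B] where
  lin : ∀ (X Y : C.Obj), C.Hom X Y →ₗ[ℂ] B
  lin_comp : ∀ (X Y Z : C.Obj) (g : C.Hom Y Z) (f : C.Hom X Y),
    lin X Z (C.comp g f) = lin Y Z g * lin X Y f
  lin_star : ∀ (X Y : C.Obj) (f : C.Hom X Y), lin Y X (C.star f) = star (lin X Y f)

/-- Index type for all representations in small C*-algebras. -/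
structure RepIdx (C : StarCatNu) : Type 1 where
  B : Type
  inst : NonUnitalCStarAlgebra B
  ρ : StarFunctor C (StarCatNu.ofAlgebra B)

instance (C : StarCatNu) (k : RepIdx C) : NonUnitalCStarAlgebra k.B := k.inst

/-- Evaluation of a representation on a morphism. -/
def RepIdx.ev {C : StarCatNu} (k : RepIdx C) {X Y : C.Obj} (f : C.Hom X Y) : k.B := k.ρ.map f

theorem RepIdx.le_maxNorm {C : StarCatNu} (k : RepIdx C) {X Y : C.Obj} (f : C.Hom X Y) :
    (‖k.ev f‖₊ : ℝ≥0∞) ≤ C.maxNorm f :=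
  le_sSup ⟨k.B, k.inst, k.ρ, rfl⟩

theorem RepIdx.maxNorm_le {C : StarCatNu} {X Y : C.Obj} (f : C.Hom X Y) (r : ℝ≥0∞)
    (h : ∀ k : RepIdx C, (‖k.ev f‖₊ : ℝ≥0∞) ≤ r) : C.maxNorm f ≤ r := by
  apply sSup_le
  rintro _ ⟨B, i, ρ, rfl⟩
  exact h ⟨B, i, ρ⟩

theorem RepIdx.norm_ev_le {C : StarCatNu} (hC : IsPreCStar C) (k : RepIdx C) {X Y : C.Obj}
    (f : C.Hom X Y) : ‖k.ev f‖ ≤ (C.maxNorm f).toReal := by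
  have := ENNReal.toReal_mono (hC X Y f).ne (k.le_maxNorm f)
  simpa using this

/-- The universal representation. -/
def uRep (C : StarCatNu) (hC : IsPreCStar C) :
    CRep C (lp (fun k : RepIdx C => k.B) ⊤) where
  lin X Y :=
    { toFun := fun f => ⟨fun k => k.ev f, memℓp_infty ⟨(C.maxNorm f).toReal, by
        rintro _ ⟨k, rfl⟩
        exact k.norm_ev_le hC f⟩⟩
      map_add' := fun f g => Subtype.ext (funext fun k => k.ρ.map_add X Y f g)
      map_smul' := fun c f => Subtype.ext (funext fun k => k.ρ.map_smul X Y c f) }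
  lin_comp X Y Z g f := Subtype.ext (funext fun k => k.ρ.map_comp X Y Z g f)
  lin_star X Y f := Subtype.ext (funext fun k => k.ρ.map_star X Y f)

theorem uRep_norm (C : StarCatNu) (hC : IsPreCStar C) {X Y : C.Obj} (f : C.Hom X Y) :
    ENNReal.ofReal ‖(uRep C hC).lin X Y f‖ = C.maxNorm f := by
  apply le_antisymm
  · rw [← ENNReal.ofReal_toReal (hC X Y f).ne]
    apply ENNReal.ofReal_le_ofReal
    exact lp.norm_le_of_forall_le ENNReal.toReal_nonneg fun k => k.norm_ev_le hC f
  · apply RepIdx.maxNorm_le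
    intro k
    have := lp.norm_apply_le_norm ENNReal.top_ne_zero ((uRep C hC).lin X Y f) k
    rw [← ENNReal.ofReal_coe_nnreal]
    exact ENNReal.ofReal_le_ofReal this

theorem uRep_inj (C : StarCatNu) (hC : IsCStar C) (X Y : C.Obj) :
    Function.Injective ((uRep C hC.1).lin X Y) := by
  rw [injective_iff_map_eq_zero]
  intro f hf
  apply hC.2.1
  rw [← uRep_norm C hC.1, hf]
  simp

theorem uRep_closed (C : StarCatNu) (hC : IsCStar C) (X Y : C.Obj) :
    IsClosed (((uRep C hC.1).lin X Y).range : Set (lp (fun k : RepIdx C => k.B) ⊤)) := by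
  have hed : ∀ f g : C.Hom X Y,
      edist ((uRep C hC.1).lin X Y f) ((uRep C hC.1).lin X Y g) = C.maxNorm (f - g) := by
    intro f g
    rw [← uRep_norm C hC.1, map_sub, edist_dist, dist_eq_norm]
  apply IsSeqClosed.isClosed
  intro x e hx hxe
  choose u hu using hx
  have hcau : CauchySeq x := hxe.cauchySeq
  obtain ⟨f, hf⟩ := hC.2.2 X Y u (by
    intro ε hε
    obtain ⟨N, hN⟩ := EMetric.cauchySeq_iff.1 hcau ε hε
    refine ⟨N, fun m hm n hn => ?_⟩
    rw [← hed, hu, hu]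
    exact hN m hm n hn)
  refine ⟨f, ?_⟩
  refine tendsto_nhds_unique ?_ hxe
  rw [EMetric.tendsto_atTop]
  intro ε hε
  obtain ⟨N, hN⟩ := hf ε hε
  refine ⟨N, fun n hn => ?_⟩
  rw [← hu, hed]
  exact hN n hn

theorem crep_isometric {C : StarCatNu} {E : Type*} [NonUnitalCStarAlgebra E]
    {B : Type*} [NonUnitalCStarAlgebra B] (U : CRep C E) (V : CRep C B)
    (hUi : ∀ X Y, Function.Injective (U.lin X Y))
    (hUc : ∀ X Y, IsClosed ((U.lin X Y).range : Set E))
    (hVi : ∀ X Y, Function.Injective (V.lin X Y)) {X Y : C.Obj} (f : C.Hom X Y) :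
    ‖V.lin X Y f‖ = ‖U.lin X Y f‖ := by
  have key : ∀ (X : C.Obj) (f : C.Hom X X), ‖V.lin X X f‖ = ‖U.lin X X f‖ := by
    intro X f
    let R : NonUnitalStarSubalgebra ℂ E :=
      { (U.lin X X).range with
        mul_mem' := by
          rintro _ _ ⟨a, rfl⟩ ⟨b, rfl⟩
          exact ⟨C.comp a b, U.lin_comp _ _ _ _ _⟩
        star_mem' := by
          rintro _ ⟨a, rfl⟩
          exact ⟨C.star a, U.lin_star _ _ _⟩ }
    have hinv : ∀ a : C.Hom X X, Function.invFun (U.lin X X) (U.lin X X a) = a :=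
      Function.leftInverse_invFun (hUi X X)
    have h := (contract_aux R (hUc X X) (fun e => V.lin X X (Function.invFun (U.lin X X) e))
      (by
        rintro _ ⟨a, rfl⟩ _ ⟨b, rfl⟩
        simp only [← map_add, hinv])
      (by
        rintro _ ⟨a, rfl⟩ _ ⟨b, rfl⟩
        simp only [← U.lin_comp, hinv, V.lin_comp])
      (by
        rintro c _ ⟨a, rfl⟩
        simp only [← map_smul, hinv])
      (by
        rintro _ ⟨a, rfl⟩
        simp only [← U.lin_star, hinv, V.lin_star])).2
      (by
        rintro _ ⟨a, rfl⟩ _ ⟨b, rfl⟩ hab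
        simp only [hinv] at hab
        rw [hVi X X hab]) (U.lin X X f) ⟨f, rfl⟩
    simpa only [hinv] using h
  have h1 := key X (C.comp (C.star f) f)
  rw [U.lin_comp, V.lin_comp, U.lin_star, V.lin_star, CStarRing.norm_star_mul_self,
    CStarRing.norm_star_mul_self] at h1
  exact (mul_self_inj (norm_nonneg _) (norm_nonneg _)).1 h1

/-- Orthogonality of a representation: noncomposable products vanish. -/
def CRep.Orth {C : StarCatNu} {B : Type uB} [NonUnitalCStarAlgebra B] (V : CRep C B) : Prop :=
  ∀ (X Y X' Y' : C.Obj) (g : C.Hom X' Y') (f : C.Hom X Y), Y ≠ X' →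
    V.lin X' Y' g * V.lin X Y f = 0

theorem norm_star_mul_mul_star {B : Type*} [NonUnitalCStarAlgebra B] (b : B) :
    ‖star b * b * star b‖ = ‖b‖ * ‖b‖ * ‖b‖ := by
  by_cases hb : b = 0
  · simp [hb]
  have hb' : 0 < ‖b‖ := norm_pos_iff.2 hb
  apply le_antisymm
  · calc _ ≤ ‖star b * b‖ * ‖star b‖ := norm_mul_le _ _
      _ = _ := by rw [CStarRing.norm_star_mul_self, norm_star]
  · have h1 : ‖star (star b * b) * (star b * b)‖ = ‖b‖ * ‖b‖ * (‖b‖ * ‖b‖) := by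
      rw [CStarRing.norm_star_mul_self, CStarRing.norm_star_mul_self]
    have h2 : star (star b * b) * (star b * b) = star b * b * star b * b := by
      simp [mul_assoc]
    rw [h2] at h1
    have h3 := norm_mul_le (star b * b * star b) b
    rw [h1] at h3
    have : (‖b‖ * ‖b‖ * ‖b‖) * ‖b‖ ≤ ‖star b * b * star b‖ * ‖b‖ := by linarith
    exact le_of_mul_le_mul_right this hb'

theorem CRep.Orth.component_le {C : StarCatNu} {B : Type*} [NonUnitalCStarAlgebra B]
    {V : CRep C B} (hV : V.Orth) (s : Finset (C.Obj × C.Obj))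
    (φ : ∀ p : C.Obj × C.Obj, C.Hom p.1 p.2) (p : C.Obj × C.Obj) (hp : p ∈ s) :
    ‖V.lin p.1 p.2 (φ p)‖ ≤ ‖∑ q ∈ s, V.lin q.1 q.2 (φ q)‖ := by
  set b := V.lin p.1 p.2 (φ p) with hb
  set x := ∑ q ∈ s, V.lin q.1 q.2 (φ q) with hx
  by_cases hb0 : b = 0
  · rw [hb0]; simp
  have hb' : 0 < ‖b‖ := norm_pos_iff.2 hb0
  have h1 : star b * x * star b = star b * b * star b := by
    rw [hx, Finset.mul_sum, Finset.sum_mul]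
    refine Finset.sum_eq_single_of_mem p hp ?_
    intro q _ hqp
    have hst : star b = V.lin p.2 p.1 (C.star (φ p)) := (V.lin_star _ _ _).symm
    rw [hst]
    by_cases h : q.2 = p.2
    · have h' : q.1 ≠ p.1 := fun h' => hqp (Prod.ext h' h)
      rw [mul_assoc, hV _ _ _ _ _ _ (Ne.symm h'), mul_zero]
    · rw [hV _ _ _ _ _ _ h, zero_mul]
  have h2 := norm_star_mul_mul_star b
  rw [← h1] at h2
  have h3 : ‖star b * x * star b‖ ≤ ‖b‖ * ‖x‖ * ‖b‖ := by
    calc _ ≤ ‖star b * x‖ * ‖star b‖ := norm_mul_le _ _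
      _ ≤ ‖star b‖ * ‖x‖ * ‖star b‖ := by gcongr; exact norm_mul_le _ _
      _ = _ := by rw [norm_star]
  rw [h2] at h3
  have h4 : ‖b‖ * ‖b‖ ≤ ‖b‖ * ‖x‖ := le_of_mul_le_mul_right h3 hb'
  exact le_of_mul_le_mul_left h4 hb'

section AAlg

variable {C : StarCatNu} {A : Type} [NonUnitalRing A] [Module ℂ A]
    [SMulCommClass ℂ A A] [IsScalarTower ℂ A A] [StarRing A] [StarModule ℂ A]

/-- The structure maps of `A^alg(C)` as linear maps. -/
def IsAAlg.lin (w : IsAAlg C A) (X Y : C.Obj) : C.Hom X Y →ₗ[ℂ] A where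
  toFun f := w.ι f
  map_add' := w.ι_add X Y
  map_smul' := w.ι_smul X Y

theorem IsAAlg.ι_zero (w : IsAAlg C A) (X Y : C.Obj) : w.ι (0 : C.Hom X Y) = 0 :=
  (w.lin X Y).map_zero

theorem IsAAlg.ι_inj (w : IsAAlg C A) {X Y : C.Obj} (f : C.Hom X Y) (hf : w.ι f = 0) :
    f = 0 := by
  classical
  have := w.indep {(X, Y)} (Function.update (fun p => (0 : C.Hom p.1 p.2)) (X, Y) f)
    (by simpa using hf) (X, Y) (by simp)
  simpa using this

/-- The representation obtained from a star homomorphism on `A^alg(C)`. -/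
def IsAAlg.rep (w : IsAAlg C A) {B : Type*} [NonUnitalCStarAlgebra B] (ψ : A →⋆ₙₐ[ℂ] B) :
    CRep C B where
  lin X Y :=
    { toFun := fun f => ψ (w.ι f)
      map_add' := fun f g => by rw [w.ι_add, map_add]
      map_smul' := fun c f => by rw [w.ι_smul, map_smul]; rfl }
  lin_comp X Y Z g f := by
    show ψ (w.ι (C.comp g f)) = ψ (w.ι g) * ψ (w.ι f)
    rw [← map_mul, w.ι_mul_comp]
  lin_star X Y f := by
    show ψ (w.ι (C.star f)) = star (ψ (w.ι f))
    rw [← map_star, w.ι_star]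

theorem IsAAlg.rep_apply (w : IsAAlg C A) {B : Type*} [NonUnitalCStarAlgebra B]
    (ψ : A →⋆ₙₐ[ℂ] B) {X Y : C.Obj} (f : C.Hom X Y) : (w.rep ψ).lin X Y f = ψ (w.ι f) := rfl

theorem IsAAlg.rep_orth (w : IsAAlg C A) {B : Type*} [NonUnitalCStarAlgebra B]
    (ψ : A →⋆ₙₐ[ℂ] B) : (w.rep ψ).Orth := by
  intro X Y X' Y' g f h
  rw [w.rep_apply, w.rep_apply, ← map_mul, w.ι_mul_ne _ _ _ _ _ _ h, map_zero]

/-- The submodule of elements supported on a finite set of objects. -/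
def IsAAlg.fin (w : IsAAlg C A) (F : Finset C.Obj) : Submodule ℂ A where
  carrier := {a | ∃ φ : ∀ p : C.Obj × C.Obj, C.Hom p.1 p.2, a = ∑ p ∈ F ×ˢ F, w.ι (φ p)}
  add_mem' := by
    rintro _ _ ⟨φ, rfl⟩ ⟨ψ, rfl⟩
    refine ⟨fun p => φ p + ψ p, ?_⟩
    simp only [w.ι_add, Finset.sum_add_distrib]
  zero_mem' := ⟨fun _ => 0, by simp [w.ι_zero]⟩
  smul_mem' := by
    rintro c _ ⟨φ, rfl⟩
    refine ⟨fun p => c • φ p, ?_⟩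
    simp only [w.ι_smul, Finset.smul_sum]

theorem IsAAlg.ι_mem_fin (w : IsAAlg C A) (F : Finset C.Obj) {X Y : C.Obj} (hX : X ∈ F)
    (hY : Y ∈ F) (f : C.Hom X Y) : w.ι f ∈ w.fin F := by
  classical
  refine ⟨Function.update (fun p => (0 : C.Hom p.1 p.2)) (X, Y) f, ?_⟩
  rw [Finset.sum_eq_single_of_mem (X, Y) (by simp [hX, hY])]
  · simp
  · intro q _ hq
    rw [Function.update_of_ne hq, w.ι_zero]

/-- The star-subalgebra of elements supported on a finite set of objects. -/
def IsAAlg.finAlg (w : IsAAlg C A) (F : Finset C.Obj) : NonUnitalStarSubalgebra ℂ A :=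
  { w.fin F with
    mul_mem' := by
      rintro _ _ ⟨φ, rfl⟩ ⟨ψ, rfl⟩
      rw [Finset.sum_mul_sum]
      refine (w.fin F).sum_mem fun p hp => (w.fin F).sum_mem fun q hq => ?_
      obtain ⟨p1, p2⟩ := p
      obtain ⟨q1, q2⟩ := q
      simp only [Finset.mem_product] at hp hq
      by_cases h : q2 = p1
      · subst h
        rw [w.ι_mul_comp]
        exact w.ι_mem_fin F hq.1 hp.2 _
      · rw [w.ι_mul_ne _ _ _ _ _ _ h]
        exact (w.fin F).zero_mem
    star_mem' := by
      rintro _ ⟨φ, rfl⟩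
      show star (∑ p ∈ F ×ˢ F, w.ι (φ p)) ∈ w.fin F
      rw [star_sum]
      refine (w.fin F).sum_mem fun p hp => ?_
      simp only [Finset.mem_product] at hp
      rw [w.ι_star]
      exact w.ι_mem_fin F hp.2 hp.1 _ }

theorem IsAAlg.mem_finAlg (w : IsAAlg C A) (a : A) : ∃ F : Finset C.Obj, a ∈ w.finAlg F := by
  classical
  obtain ⟨s, φ, rfl⟩ := w.span a
  refine ⟨s.image Prod.fst ∪ s.image Prod.snd, ?_⟩
  refine (w.fin _).sum_mem fun p hp => w.ι_mem_fin _ ?_ ?_ _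
  · exact Finset.mem_union_left _ (Finset.mem_image_of_mem _ hp)
  · exact Finset.mem_union_right _ (Finset.mem_image_of_mem _ hp)

theorem IsAAlg.finAlg_closed (hC : IsCStar C) (w : IsAAlg C A) {B : Type}
    [NonUnitalCStarAlgebra B] (ψ : A →⋆ₙₐ[ℂ] B) (hψ : Function.Injective ψ)
    (F : Finset C.Obj) : IsClosed (ψ '' (w.finAlg F : Set A)) := by
  classical
  set U := uRep C hC.1 with hU
  have hUi := uRep_inj C hC
  have hUc := uRep_closed C hC
  let V := w.rep ψ
  have hVi : ∀ X Y, Function.Injective (V.lin X Y) := by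
    intro X Y
    rw [injective_iff_map_eq_zero]
    intro f hf
    apply w.ι_inj
    apply hψ
    rw [map_zero]
    exact hf
  have hVn : ∀ (X Y : C.Obj) (f : C.Hom X Y), ‖V.lin X Y f‖ = ‖U.lin X Y f‖ :=
    fun X Y f => crep_isometric U V hUi hUc hVi f
  let e : ∀ p : C.Obj × C.Obj, C.Hom p.1 p.2 ≃ₗ[ℂ] (U.lin p.1 p.2).range :=
    fun p => LinearEquiv.ofInjective (U.lin p.1 p.2) (hUi p.1 p.2)
  have hen : ∀ p (f : C.Hom p.1 p.2), ‖e p f‖ = ‖V.lin p.1 p.2 f‖ := fun p f => (hVn _ _ f).symm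
  let L : ∀ p : C.Obj × C.Obj, (U.lin p.1 p.2).range →L[ℂ] B := fun p =>
    LinearMap.mkContinuous ((V.lin p.1 p.2).comp (e p).symm.toLinearMap) 1 (by
      intro x
      have := hen p ((e p).symm x)
      rw [LinearEquiv.apply_symm_apply] at this
      rw [this, one_mul]
      rfl)
  have hL : ∀ p x, L p x = V.lin p.1 p.2 ((e p).symm x) := fun p x => rfl
  let P := F ×ˢ F
  let T : (∀ p : P, (U.lin p.1.1 p.1.2).range) →L[ℂ] B :=
    ∑ p : P, (L p.1).comp (ContinuousLinearMap.proj p)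
  have hT : ∀ x, T x = ∑ p : P, V.lin p.1.1 p.1.2 ((e p.1).symm (x p)) := by
    intro x
    simp only [T, sum_apply]
    rfl
  have hanti : AntilipschitzWith 1 T := by
    apply AddMonoidHomClass.antilipschitz_of_bound
    intro x
    rw [NNReal.coe_one, one_mul, pi_norm_le_iff_of_nonneg (norm_nonneg _)]
    intro p
    let φ : ∀ q : C.Obj × C.Obj, C.Hom q.1 q.2 := fun q =>
      if h : q ∈ P then (e q).symm (x ⟨q, h⟩) else 0
    have hφ : ∀ q : P, φ q.1 = (e q.1).symm (x q) := fun q => dif_pos q.2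
    have h1 := (w.rep_orth ψ).component_le P φ p.1 p.2
    rw [← Finset.sum_coe_sort P] at h1
    simp only [hφ] at h1
    rw [hT]
    refine le_trans (le_of_eq ?_) h1
    have := hen p.1 ((e p.1).symm (x p))
    rw [LinearEquiv.apply_symm_apply] at this
    exact this
  have : ∀ p : P, CompleteSpace (U.lin p.1.1 p.1.2).range := fun p =>
    (hUc p.1.1 p.1.2).completeSpace_coe
  have hcl := hanti.isClosed_range T.uniformContinuous
  convert hcl using 1
  ext b
  constructor
  · rintro ⟨_, ⟨φ, rfl⟩, rfl⟩
    refine ⟨fun p => e p.1 (φ p.1), ?_⟩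
    rw [hT]
    simp only [LinearEquiv.symm_apply_apply]
    rw [Finset.sum_coe_sort P (fun p => V.lin p.1 p.2 (φ p)), map_sum]
    rfl
  · rintro ⟨x, rfl⟩
    rw [hT]
    refine ⟨∑ p : P, w.ι ((e p.1).symm (x p)), ?_, ?_⟩
    · refine (w.fin F).sum_mem fun p _ => w.ι_mem_fin F ?_ ?_ _
      · exact (Finset.mem_product.1 p.2).1
      · exact (Finset.mem_product.1 p.2).2
    · rw [map_sum]; rfl

theorem IsAAlg.norm_le (hC : IsCStar C) (w : IsAAlg C A) {B B' : Type}
    [NonUnitalCStarAlgebra B] [NonUnitalCStarAlgebra B'] (ψ : A →⋆ₙₐ[ℂ] B)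
    (hψ : Function.Injective ψ) (φ : A →⋆ₙₐ[ℂ] B') (a : A) : ‖φ a‖ ≤ ‖ψ a‖ := by
  obtain ⟨F, hF⟩ := w.mem_finAlg a
  have hinv : ∀ a : A, Function.invFun ψ (ψ a) = a := Function.leftInverse_invFun hψ
  have h := (contract_aux ((w.finAlg F).map ψ) (w.finAlg_closed hC ψ hψ F)
    (fun b => φ (Function.invFun ψ b))
    (by
      rintro _ ⟨a, _, rfl⟩ _ ⟨b, _, rfl⟩
      change φ (Function.invFun ψ (ψ a + ψ b)) = φ (Function.invFun ψ (ψ a)) +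
        φ (Function.invFun ψ (ψ b))
      simp only [← map_add, hinv])
    (by
      rintro _ ⟨a, _, rfl⟩ _ ⟨b, _, rfl⟩
      change φ (Function.invFun ψ (ψ a * ψ b)) = φ (Function.invFun ψ (ψ a)) *
        φ (Function.invFun ψ (ψ b))
      simp only [← map_mul, hinv])
    (by
      rintro c _ ⟨a, _, rfl⟩
      change φ (Function.invFun ψ (c • ψ a)) = c • φ (Function.invFun ψ (ψ a))
      simp only [← map_smul, hinv])
    (by
      rintro _ ⟨a, _, rfl⟩
      change φ (Function.invFun ψ (star (ψ a))) = star (φ (Function.invFun ψ (ψ a)))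
      simp only [← map_star, hinv])).1 (ψ a) ⟨a, hF, rfl⟩
  simpa only [hinv] using h

theorem IsAAlg.algMaxNorm_eq (hC : IsCStar C) (w : IsAAlg C A) {B : Type}
    [NonUnitalCStarAlgebra B] (ψ : A →⋆ₙₐ[ℂ] B) (hψ : Function.Injective ψ) (a : A) :
    algMaxNorm A a = (‖ψ a‖₊ : ℝ≥0∞) := by
  apply le_antisymm
  · apply sSup_le
    rintro _ ⟨B', i, φ, rfl⟩
    exact ENNReal.coe_le_coe.2 (w.norm_le hC ψ hψ φ a)
  · exact le_sSup ⟨B, inferInstance, ψ, rfl⟩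

/-- The direct sum decomposition of `A^alg(C)`. -/
theorem IsAAlg.exists_lift (w : IsAAlg C A) {B : Type} [NonUnitalCStarAlgebra B]
    (V : CRep C B) (hV : V.Orth) :
    ∃ θ : A →⋆ₙₐ[ℂ] B, ∀ (X Y : C.Obj) (f : C.Hom X Y), θ (w.ι f) = V.lin X Y f := by
  classical
  let S : (Π₀ p : C.Obj × C.Obj, C.Hom p.1 p.2) →ₗ[ℂ] A :=
    DFinsupp.lsum ℂ (fun p : C.Obj × C.Obj => w.lin p.1 p.2)
  let S' : (Π₀ p : C.Obj × C.Obj, C.Hom p.1 p.2) →ₗ[ℂ] B :=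
    DFinsupp.lsum ℂ (fun p : C.Obj × C.Obj => V.lin p.1 p.2)
  have hS : ∀ p (f : C.Hom p.1 p.2), S (DFinsupp.single p f) = w.ι f := by
    intro p f
    apply DFinsupp.lsum_single
  have hS' : ∀ p (f : C.Hom p.1 p.2), S' (DFinsupp.single p f) = V.lin p.1 p.2 f := by
    intro p f
    apply DFinsupp.lsum_single
  have hinj : Function.Injective S := by
    rw [injective_iff_map_eq_zero]
    intro m hm
    have hm' : m = ∑ p ∈ m.support, DFinsupp.single p (m p) := (DFinsupp.sum_single (f := m)).symm
    rw [hm', map_sum] at hm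
    simp only [hS] at hm
    have := w.indep _ _ hm
    ext p
    by_cases hp : p ∈ m.support
    · exact this p hp
    · simpa using hp
  have hsurj : Function.Surjective S := by
    intro a
    obtain ⟨s, φ, rfl⟩ := w.span a
    refine ⟨∑ p ∈ s, DFinsupp.single p (φ p), ?_⟩
    rw [map_sum]
    simp only [hS]
  let e := LinearEquiv.ofBijective S ⟨hinj, hsurj⟩
  let θ : A →ₗ[ℂ] B := S'.comp e.symm.toLinearMap
  have hθ : ∀ (X Y : C.Obj) (f : C.Hom X Y), θ (w.ι f) = V.lin X Y f := by
    intro X Y f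
    have h1 : e.symm (w.ι f) = DFinsupp.single (X, Y) f := by
      rw [LinearEquiv.symm_apply_eq]
      exact (hS (X, Y) f).symm
    show S' (e.symm (w.ι f)) = _
    rw [h1]
    exact hS' (X, Y) f
  refine ⟨{ toFun := θ, map_smul' := θ.map_smul, map_zero' := θ.map_zero, map_add' := θ.map_add,
            map_mul' := ?_, map_star' := ?_ }, hθ⟩
  · intro a b
    obtain ⟨s, φ, rfl⟩ := w.span a
    obtain ⟨t, χ, rfl⟩ := w.span b
    simp only [Finset.sum_mul_sum, map_sum]
    refine Finset.sum_congr rfl fun p _ => Finset.sum_congr rfl fun q _ => ?_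
    obtain ⟨p1, p2⟩ := p
    obtain ⟨q1, q2⟩ := q
    rw [hθ, hθ]
    by_cases h : q2 = p1
    · subst h
      rw [w.ι_mul_comp, hθ, V.lin_comp]
    · rw [w.ι_mul_ne _ _ _ _ _ _ h, map_zero, hV _ _ _ _ _ _ h]
  · intro a
    obtain ⟨s, φ, rfl⟩ := w.span a
    simp only [star_sum, map_sum, w.ι_star, hθ, V.lin_star]

end AAlg

/-- Matrix unit type operators on an `ℓ²` direct sum. -/
def matUnit {I : Type} {H : Type} [NormedAddCommGroup H] [InnerProductSpace ℂ H]
    (X Y : I) (T : H →L[ℂ] H) : lp (fun _ : I => H) 2 →L[ℂ] lp (fun _ : I => H) 2 :=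
  by
    classical
    exact (lp.singleContinuousLinearMap ℂ (fun _ : I => H) 2 Y).comp
      (T.comp (lp.evalCLM ℂ (fun _ : I => H) 2 X))

open Classical in
theorem matUnit_apply {I : Type} {H : Type} [NormedAddCommGroup H] [InnerProductSpace ℂ H]
    (X Y : I) (T : H →L[ℂ] H) (v : lp (fun _ : I => H) 2) :
    matUnit X Y T v = lp.single 2 Y (T (v X)) := rfl

theorem matUnit_star {I : Type} {H : Type} [NormedAddCommGroup H] [InnerProductSpace ℂ H]
    [CompleteSpace H] (X Y : I) (T : H →L[ℂ] H) :
    matUnit Y X (star T) = star (matUnit X Y T) := by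
  classical
  rw [ContinuousLinearMap.star_eq_adjoint, ContinuousLinearMap.star_eq_adjoint,
    ContinuousLinearMap.eq_adjoint_iff]
  intro v w
  rw [matUnit_apply, matUnit_apply, lp.inner_single_left, lp.inner_single_right,
    ContinuousLinearMap.adjoint_inner_left]

/-- The orthogonal representation on `ℓ²(Ob, H)` induced by a representation. -/
def l2Rep (C : StarCatNu) {B : Type} [NonUnitalCStarAlgebra B]
    (ρ : StarFunctor C (StarCatNu.ofAlgebra B)) {H : Type} [NormedAddCommGroup H]
    [InnerProductSpace ℂ H] [CompleteSpace H] (π : B →⋆ₙₐ[ℂ] (H →L[ℂ] H)) :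
    CRep C (lp (fun _ : C.Obj => H) 2 →L[ℂ] lp (fun _ : C.Obj => H) 2) where
  lin X Y :=
    { toFun := fun f => matUnit X Y (π (ρ.map f))
      map_add' := fun f g => by
        have h : π (ρ.map (f + g)) = π (ρ.map f) + π (ρ.map g) := by
          rw [ρ.map_add]; exact map_add π _ _
        classical
        ext1 v
        rw [h, ContinuousLinearMap.add_apply]
        simp only [matUnit_apply, ContinuousLinearMap.add_apply]
        exact map_add (lp.singleContinuousLinearMap ℂ (fun _ : C.Obj => H) 2 Y) _ _
      map_smul' := fun c f => by
        have h : π (ρ.map (c • f)) = c • π (ρ.map f) := by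
          rw [ρ.map_smul]; exact map_smul π _ _
        classical
        ext1 v
        rw [h, RingHom.id_apply, ContinuousLinearMap.smul_apply]
        simp only [matUnit_apply, ContinuousLinearMap.smul_apply]
        exact map_smul (lp.singleContinuousLinearMap ℂ (fun _ : C.Obj => H) 2 Y) _ _ }
  lin_comp X Y Z g f := by
    classical
    have h : π (ρ.map (C.comp g f)) = π (ρ.map g) * π (ρ.map f) := by
      rw [ρ.map_comp]; exact map_mul π _ _
    show matUnit X Z (π (ρ.map (C.comp g f))) = matUnit Y Z _ * matUnit X Y _
    ext1 v
    rw [h]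
    simp [matUnit_apply]
  lin_star X Y f := by
    classical
    have h : π (ρ.map (C.star f)) = star (π (ρ.map f)) := by
      rw [ρ.map_star]; exact map_star π _
    show matUnit Y X (π (ρ.map (C.star f))) = star (matUnit X Y (π (ρ.map f)))
    rw [h]
    exact matUnit_star X Y _

theorem l2Rep_orth (C : StarCatNu) {B : Type} [NonUnitalCStarAlgebra B]
    (ρ : StarFunctor C (StarCatNu.ofAlgebra B)) {H : Type} [NormedAddCommGroup H]
    [InnerProductSpace ℂ H] [CompleteSpace H] (π : B →⋆ₙₐ[ℂ] (H →L[ℂ] H)) :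
    (l2Rep C ρ π).Orth := by
  classical
  intro X Y X' Y' g f hne
  show matUnit X' Y' (π (ρ.map g)) * matUnit X Y (π (ρ.map f)) = 0
  ext1 v
  rw [ContinuousLinearMap.mul_apply, matUnit_apply, matUnit_apply]
  have h0 : (lp.single 2 Y ((π (ρ.map f)) (v X)) : lp (fun _ : C.Obj => H) 2) X' = 0 := by
    rw [lp.coeFn_single]
    exact Pi.single_eq_of_ne (Ne.symm hne) _
  rw [h0, map_zero]
  exact map_zero (lp.singleContinuousLinearMap ℂ (fun _ : C.Obj => H) 2 Y')

theorem IsAAlg.algMaxNorm_ne_zero {C : StarCatNu} (hC : IsCStar C) {A : Type} [NonUnitalRing A]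
    [Module ℂ A] [SMulCommClass ℂ A A] [IsScalarTower ℂ A A] [StarRing A] [StarModule ℂ A]
    (w : IsAAlg C A) {X Y : C.Obj} (f : C.Hom X Y) (hf : f ≠ 0) : algMaxNorm A (w.ι f) ≠ 0 := by
  classical
  intro h0
  have h1 : ∃ k : RepIdx C, k.ev f ≠ 0 := by
    by_contra! hcon
    apply hf
    apply hC.2.1
    apply le_antisymm _ zero_le
    apply RepIdx.maxNorm_le
    intro k
    simp [hcon k]
  obtain ⟨k, hk⟩ := h1
  obtain ⟨H, _, _, _, π, hπ⟩ := exists_hilbert_rep (k.ev f) hk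
  obtain ⟨θ, hθ⟩ := w.exists_lift (l2Rep C k.ρ π) (l2Rep_orth C k.ρ π)
  have h2 : (‖θ (w.ι f)‖₊ : ℝ≥0∞) ≤ algMaxNorm A (w.ι f) := le_sSup ⟨_, inferInstance, θ, rfl⟩
  rw [h0, hθ] at h2
  have h3 : (l2Rep C k.ρ π).lin X Y f = 0 := by simpa using h2
  apply hπ
  ext1 v
  have h4 : matUnit X Y (π (k.ev f)) (lp.single 2 X v) = 0 := by
    have : matUnit X Y (π (k.ev f)) = 0 := h3
    rw [this]; rfl
  rw [matUnit_apply] at h4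
  have h5 : (lp.single 2 X v : lp (fun _ : C.Obj => H) 2) X = v := by
    rw [lp.coeFn_single]; exact Pi.single_eq_same _ _
  rw [h5] at h4
  have h6 := congrArg (fun u : lp (fun _ : C.Obj => H) 2 => u Y) h4
  simp only [lp.coeFn_single] at h6
  rw [Pi.single_eq_same] at h6
  exact h6

/-- (1) The functor `A : C*Cat^nu_inj → C*Alg^nu` preserves isometric inclusions: if
`i : C → D` is a morphism of possibly non-unital small C*-categories that is injective on
objects and an isometric inclusion on morphism spaces, then `A(i) : A(C) → A(D)` is an
isometric inclusion of C*-algebras.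
(2) For `C` in `C*Cat^nu`, every injective ∗-homomorphism `A^alg(C) → B` into a
C*-algebra `B` extends to an isometric homomorphism `A(C) → B`. -/
theorem AFunctor_preserves_isometric_inclusions_and_extension :
    (∀ (C D : StarCatNu), IsCStar C → IsCStar D →
      ∀ (i : StarFunctor C D), Function.Injective i.obj →
        (∀ (X Y : C.Obj) (f : C.Hom X Y), D.maxNorm (i.map f) = C.maxNorm f) →
        ∀ (AC : Type) [NonUnitalRing AC] [Module ℂ AC] [SMulCommClass ℂ AC AC]
          [IsScalarTower ℂ AC AC] [StarRing AC] [StarModule ℂ AC],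
        ∀ (wC : IsAAlg C AC)
          (AC' : Type) [NonUnitalCStarAlgebra AC'] (jC : AC →⋆ₙₐ[ℂ] AC')
          (_ : IsAlgCompletion AC AC' jC),
        ∀ (AD : Type) [NonUnitalRing AD] [Module ℂ AD] [SMulCommClass ℂ AD AD]
          [IsScalarTower ℂ AD AD] [StarRing AD] [StarModule ℂ AD],
        ∀ (wD : IsAAlg D AD)
          (AD' : Type) [NonUnitalCStarAlgebra AD'] (jD : AD →⋆ₙₐ[ℂ] AD')
          (_ : IsAlgCompletion AD AD' jD),
        ∀ (Φ : AC' →⋆ₙₐ[ℂ] AD'),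
          (∀ (X Y : C.Obj) (f : C.Hom X Y), Φ (jC (wC.ι f)) = jD (wD.ι (i.map f))) →
          (Function.Injective Φ ∧ ∀ a : AC', ‖Φ a‖ = ‖a‖)) ∧
    (∀ (C : StarCatNu), IsCStar C →
      ∀ (AC : Type) [NonUnitalRing AC] [Module ℂ AC] [SMulCommClass ℂ AC AC]
        [IsScalarTower ℂ AC AC] [StarRing AC] [StarModule ℂ AC],
      ∀ (wC : IsAAlg C AC)
        (AC' : Type) [NonUnitalCStarAlgebra AC'] (jC : AC →⋆ₙₐ[ℂ] AC')
        (_ : IsAlgCompletion AC AC' jC),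
      ∀ (B : Type) [NonUnitalCStarAlgebra B] (ψ : AC →⋆ₙₐ[ℂ] B),
        Function.Injective ψ →
        ∃ Ψ : AC' →⋆ₙₐ[ℂ] B, (∀ a : AC, Ψ (jC a) = ψ a) ∧ ∀ x : AC', ‖Ψ x‖ = ‖x‖) := by

  constructor
  · intro C D hC hD i hi hiso AC _ _ _ _ _ _ wC AC' _ jC hjC AD _ _ _ _ _ _ wD AD' _ jD hjD Φ hΦ
    let ψ : AC →⋆ₙₐ[ℂ] AD' := Φ.comp jC
    have hψι : ∀ (X Y : C.Obj) (f : C.Hom X Y), ψ (wC.ι f) = jD (wD.ι (i.map f)) := hΦ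
    have hinj : Function.Injective ψ := by
      rw [injective_iff_map_eq_zero]
      intro a ha
      obtain ⟨s, φ, rfl⟩ := wC.span a
      refine Finset.sum_eq_zero fun p hp => ?_
      have h1 := (wC.rep_orth ψ).component_le s φ p hp
      simp only [wC.rep_apply] at h1
      rw [← map_sum, ha, norm_zero, hψι] at h1
      have h2 : ‖jD (wD.ι (i.map (φ p)))‖ = 0 := le_antisymm h1 (norm_nonneg _)
      have h3 : algMaxNorm AD (wD.ι (i.map (φ p))) = 0 := by
        rw [← hjD.isometric]
        simpa using h2
      have h4 : i.map (φ p) = 0 := by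
        by_contra hne
        exact wD.algMaxNorm_ne_zero hD _ hne h3
      have h5 : φ p = 0 := by
        apply hC.2.1
        rw [← hiso, h4, ← uRep_norm D hD.1, map_zero]
        simp
      rw [h5, wC.ι_zero]
    have hn : ∀ a : AC, ‖Φ (jC a)‖ = ‖jC a‖ := by
      intro a
      have h1 := wC.algMaxNorm_eq hC ψ hinj a
      rw [← hjC.isometric] at h1
      have h2 := ENNReal.coe_inj.1 h1
      exact (congrArg NNReal.toReal h2).symm
    have hc : Continuous Φ :=
      AddMonoidHomClass.continuous_of_bound Φ 1
        (fun x => by rw [one_mul]; exact NonUnitalStarAlgHom.norm_apply_le Φ x)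
    have hall : ∀ a : AC', ‖Φ a‖ = ‖a‖ := fun a =>
      hjC.dense.induction_on (p := fun a => ‖Φ a‖ = ‖a‖) a
        (isClosed_eq hc.norm continuous_norm) hn
    refine ⟨?_, hall⟩
    rw [injective_iff_map_eq_zero]
    intro a ha
    rw [← norm_eq_zero, ← hall, ha, norm_zero]
  · intro C hC AC _ _ _ _ _ _ wC AC' _ jC hjC B _ ψ hψ
    have hn : ∀ a : AC, ‖ψ a‖ = ‖jC a‖ := by
      intro a
      have h1 := wC.algMaxNorm_eq hC ψ hψ a
      rw [← hjC.isometric] at h1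
      exact (congrArg NNReal.toReal (ENNReal.coe_inj.1 h1)).symm
    let jl : AC →ₗ[ℂ] AC' :=
      { toFun := jC, map_add' := map_add jC, map_smul' := map_smul jC }
    let ψl : AC →ₗ[ℂ] B :=
      { toFun := ψ, map_add' := map_add ψ, map_smul' := map_smul ψ }
    let T : AC' →L[ℂ] B := ψl.extendOfNorm jl
    have hT : ∀ a, T (jC a) = ψ a := fun a =>
      LinearMap.extendOfNorm_eq (f := ψl) (e := jl) hjC.dense
        ⟨1, fun x => by rw [one_mul]; exact (hn x).le⟩ a
    refine ⟨{ toFun := T, map_smul' := T.map_smul, map_zero' := T.map_zero,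
              map_add' := T.map_add, map_mul' := ?_, map_star' := ?_ }, hT, ?_⟩
    · intro x y
      refine hjC.dense.induction_on₂ (p := fun x y => T (x * y) = T x * T y) ?_ ?_ x y
      · exact isClosed_eq (by fun_prop) (by fun_prop)
      · intro a b
        rw [← map_mul, hT, hT, hT, map_mul]
    · intro x
      refine hjC.dense.induction_on (p := fun x => T (star x) = star (T x)) x ?_ ?_
      · exact isClosed_eq (by fun_prop) (by fun_prop)
      · intro a
        rw [← map_star, hT, hT, map_star]
    · intro x
      refine hjC.dense.induction_on (p := fun x => ‖T x‖ = ‖x‖) x ?_ ?_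
      · exact isClosed_eq (by fun_prop) (by fun_prop)
      · intro a
        rw [hT, hn]
end
end

section
/- Let C be a possibly non-unital small C*-category with an action of a group G. Then the canonical functor ι_C : C → C⋊G, which is the identity on objects and sends a morphism f to (f,e), is isometric on all morphism spaces. -/
noncomputable section

open scoped ENNReal

/-- An action of a group `G` on a possibly non-unital ℂ-linear ∗-category `C` by
automorphisms (an object of `Fun(BG, ∗Cat^nu_ℂ)`). -/
structure GAction (G : Type) [Group G] (C : StarCatNu) where
  actObj : G → C.Obj → C.Obj
  actMap : ∀ (g : G) {X Y : C.Obj}, C.Hom X Y → C.Hom (actObj g X) (actObj g Y)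
  one_obj : ∀ X : C.Obj, actObj 1 X = X
  mul_obj : ∀ (g h : G) (X : C.Obj), actObj g (actObj h X) = actObj (g * h) X
  one_map : ∀ (X Y : C.Obj) (f : C.Hom X Y),
    C.castHom (one_obj X) (one_obj Y) (actMap 1 f) = f
  mul_map : ∀ (g h : G) (X Y : C.Obj) (f : C.Hom X Y),
    C.castHom (mul_obj g h X) (mul_obj g h Y) (actMap g (actMap h f)) = actMap (g * h) f
  map_add : ∀ (g : G) (X Y : C.Obj) (f f' : C.Hom X Y),
    actMap g (f + f') = actMap g f + actMap g f'
  map_smul : ∀ (g : G) (X Y : C.Obj) (c : ℂ) (f : C.Hom X Y),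
    actMap g (c • f) = c • actMap g f
  map_comp : ∀ (g : G) (X Y Z : C.Obj) (u : C.Hom Y Z) (f : C.Hom X Y),
    actMap g (C.comp u f) = C.comp (actMap g u) (actMap g f)
  map_star : ∀ (g : G) (X Y : C.Obj) (f : C.Hom X Y),
    actMap g (C.star f) = C.star (actMap g f)

namespace GAction

variable {G : Type} [Group G] {C : StarCatNu}

/-- The automorphism of `C` given by the action of `g`. -/
def functor (α : GAction G C) (g : G) : StarFunctor C C where
  obj := α.actObj g
  map := α.actMap g
  map_add := α.map_add g
  map_smul := α.map_smul g
  map_comp := α.map_comp g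
  map_star := α.map_star g

theorem inv_mul_obj (α : GAction G C) (g g' : G) (Z : C.Obj) :
    α.actObj g⁻¹ (α.actObj g'⁻¹ Z) = α.actObj (g' * g)⁻¹ Z := by
  rw [α.mul_obj, mul_inv_rev]

theorem cancel_obj (α : GAction G C) (g : G) (Y : C.Obj) :
    α.actObj g (α.actObj g⁻¹ Y) = Y := by
  rw [α.mul_obj, mul_inv_cancel, α.one_obj]

theorem inv_inv_obj (α : GAction G C) (g : G) (X : C.Obj) :
    α.actObj g⁻¹⁻¹ X = α.actObj g X := by rw [inv_inv]

theorem one_inv_obj (α : GAction G C) (Y : C.Obj) :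
    α.actObj (1 : G)⁻¹ Y = Y := by rw [inv_one, α.one_obj]

theorem lc_obj (α : GAction G C) (a b : G) (Y : C.Obj) :
    α.actObj a⁻¹ Y = α.actObj (b⁻¹ * a)⁻¹ (α.actObj b⁻¹ Y) := by
  rw [α.mul_obj]
  congr 1
  group

end GAction

/-- `CG` together with the data `obj`, `ins` is a realization of the algebraic crossed
product `C ⋊^alg G`: its objects are those of `C`, its morphism spaces are the direct sums
`⊕_{g ∈ G} Hom_C(X, g⁻¹Y)` (the element of the `g`-th summand corresponding to `f` being
`ins g f`, i.e. `(f, g)`), with composition `(f', g') ∘ (f, g) = (g⁻¹f' ∘ f, g'g)` and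
involution `(f, g)* = (g f*, g⁻¹)`. -/
structure IsCrossedProductAlg (G : Type) [Group G] (C : StarCatNu) (α : GAction G C)
    (CG : StarCatNu) where
  obj : C.Obj → CG.Obj
  obj_bij : Function.Bijective obj
  ins : ∀ (g : G) {X Y : C.Obj}, C.Hom X (α.actObj g⁻¹ Y) → CG.Hom (obj X) (obj Y)
  ins_add : ∀ (g : G) (X Y : C.Obj) (f f' : C.Hom X (α.actObj g⁻¹ Y)),
    ins g (f + f') = ins g f + ins g f'
  ins_smul : ∀ (g : G) (X Y : C.Obj) (c : ℂ) (f : C.Hom X (α.actObj g⁻¹ Y)),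
    ins g (c • f) = c • ins g f
  ins_comp : ∀ (g g' : G) (X Y Z : C.Obj)
    (f : C.Hom X (α.actObj g⁻¹ Y)) (f' : C.Hom Y (α.actObj g'⁻¹ Z)),
    CG.comp (ins g' f') (ins g f) =
      ins (g' * g) (C.castHom rfl (α.inv_mul_obj g g' Z)
        (C.comp (α.actMap g⁻¹ f') f))
  ins_star : ∀ (g : G) (X Y : C.Obj) (f : C.Hom X (α.actObj g⁻¹ Y)),
    CG.star (ins g f) =
      ins g⁻¹ (C.castHom (α.cancel_obj g Y) (α.inv_inv_obj g X).symm
        (α.actMap g (C.star f)))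
  span : ∀ (X Y : C.Obj) (u : CG.Hom (obj X) (obj Y)),
    ∃ (s : Finset G) (φ : ∀ g : G, C.Hom X (α.actObj g⁻¹ Y)),
      u = s.sum fun g => ins g (φ g)
  indep : ∀ (X Y : C.Obj) (s : Finset G) (φ : ∀ g : G, C.Hom X (α.actObj g⁻¹ Y)),
    (s.sum fun g => ins g (φ g)) = 0 → ∀ g ∈ s, φ g = 0


namespace CrossedAux

open scoped ComplexOrder InnerProductSpace

/-- Existence of a norming state. -/
theorem exists_state {A : Type} [CStarAlgebra A] [PartialOrder A] [StarOrderedRing A]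
    [Nontrivial A] (a : A) (ha : 0 ≤ a) :
    ∃ φ : A →ₚ[ℂ] ℂ, φ 1 = 1 ∧ φ a = (‖a‖ : ℂ) := by
  have h1 : ‖(1 : A) + a‖ = 1 + ‖a‖ := by
    apply le_antisymm
    · refine (norm_add_le _ _).trans ?_
      simp
    · have hs : ‖a‖ ∈ spectrum ℝ a := CStarAlgebra.norm_mem_spectrum_of_nonneg ha
      have hs' : (1 : ℝ) + ‖a‖ ∈ spectrum ℝ ((1 : A) + a) := by
        have := spectrum.add_mem_add_iff (r := ‖a‖) (s := (1 : ℝ)) (a := a)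
        rw [map_one] at this
        rw [add_comm 1 ‖a‖]
        exact this.2 hs
      have := spectrum.norm_le_norm_of_mem hs'
      rwa [Real.norm_of_nonneg (by positivity)] at this
  have hne : (1 : A) + a ≠ 0 := by
    rw [← norm_ne_zero_iff, h1]; positivity
  obtain ⟨f, hf, hfa⟩ := exists_dual_vector ℂ ((1 : A) + a) (norm_ne_zero_iff.2 hne)
  have hfle : ∀ x, ‖f x‖ ≤ ‖x‖ := fun x => by simpa [hf] using f.le_opNorm x
  have hf1 : ‖f 1‖ ≤ 1 := by simpa using hfle 1
  have hf2 := hfle a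
  have hre : (f 1).re + (f a).re = 1 + ‖a‖ := by
    have := congrArg Complex.re hfa
    rw [map_add, h1] at this
    simpa using this
  have hr1 : (f 1).re = 1 := by
    have h3 := Complex.re_le_norm (f 1)
    have h4 := Complex.re_le_norm (f a)
    linarith
  have hra : (f a).re = ‖a‖ := by linarith
  let φ₀ : A →ₗ[ℂ] ℂ :=
    { toFun := fun x => (f x + star (f (star x))) / 2
      map_add' := fun x y => by simp only [star_add, map_add]; ring
      map_smul' := fun c x => by
        simp only [star_smul, map_smul, smul_eq_mul, star_mul, star_star, RingHom.id_apply]; ring }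
  have hφ : ∀ x, IsSelfAdjoint x → φ₀ x = ((f x).re : ℂ) := by
    intro x hx
    show (f x + star (f (star x))) / 2 = _
    rw [hx.star_eq]
    apply Complex.ext <;> simp
  have hpos : ∀ x, 0 ≤ x → ‖x‖ ≤ 1 → 0 ≤ (f x).re := by
    intro x hx hx1
    have hx2 : ‖1 - x‖ ≤ 1 := by
      have h3 : x ≤ 1 := (CStarAlgebra.norm_le_one_iff_of_nonneg x hx).1 hx1
      exact (CStarAlgebra.norm_le_one_iff_of_nonneg (1 - x) (sub_nonneg.2 h3)).2
        (sub_le_self _ hx)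
    have h4 := (Complex.re_le_norm (f (1 - x))).trans ((hfle _).trans hx2)
    rw [map_sub, Complex.sub_re, hr1] at h4
    linarith
  refine ⟨PositiveLinearMap.mk₀ φ₀ ?_, ?_, ?_⟩
  · intro x hx
    rw [hφ x (IsSelfAdjoint.of_nonneg hx)]
    rw [Complex.zero_le_real]
    by_cases hx0 : x = 0
    · simp [hx0]
    have hn : 0 < ‖x‖ := norm_pos_iff.2 hx0
    have h5 := hpos ((‖x‖⁻¹ : ℝ) • x) (smul_nonneg (by positivity) hx)
      (by rw [norm_smul]; simp [hn.ne'])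
    rw [← Complex.coe_smul, map_smul] at h5
    simp only [smul_eq_mul, Complex.re_ofReal_mul] at h5
    exact nonneg_of_mul_nonneg_right h5 (by positivity)
  · show φ₀ 1 = 1
    rw [hφ 1 (IsSelfAdjoint.one A), hr1]; simp
  · show φ₀ a = _
    rw [hφ a (IsSelfAdjoint.of_nonneg ha), hra]

theorem exists_rep_unital {A : Type} [CStarAlgebra A] [Nontrivial A] (b : A) :
    ∃ (H : Type) (_ : NormedAddCommGroup H) (_ : InnerProductSpace ℂ H) (_ : CompleteSpace H)
      (π : A →⋆ₙₐ[ℂ] (H →L[ℂ] H)), ‖b‖ ≤ ‖π b‖ := by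
  let _ := CStarAlgebra.spectralOrder A
  have _ := CStarAlgebra.spectralOrderedRing A
  obtain ⟨φ, h1, h2⟩ := exists_state (star b * b) (star_mul_self_nonneg b)
  refine ⟨φ.GNS, inferInstance, inferInstance, inferInstance, φ.gnsNonUnitalStarAlgHom, ?_⟩
  have hn1 : ‖φ.toPreGNS 1‖ = 1 := by
    rw [PositiveLinearMap.preGNS_norm_def]; simp [h1]
  have hnb : ‖φ.toPreGNS b‖ = ‖b‖ := by
    rw [PositiveLinearMap.preGNS_norm_def]
    simp only [PositiveLinearMap.ofPreGNS_toPreGNS]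
    rw [h2, CStarRing.norm_star_mul_self]
    simp
  have := (φ.gnsNonUnitalStarAlgHom b).le_opNorm ((φ.toPreGNS 1 : φ.PreGNS) : φ.GNS)
  rw [PositiveLinearMap.gnsNonUnitalStarAlgHom_apply_coe, UniformSpace.Completion.norm_coe,
    UniformSpace.Completion.norm_coe, hn1, mul_one] at this
  rw [← hnb]
  simpa using this

theorem exists_rep {B : Type} [NonUnitalCStarAlgebra B] (b : B) :
    ∃ (H : Type) (_ : NormedAddCommGroup H) (_ : InnerProductSpace ℂ H) (_ : CompleteSpace H)
      (π : B →⋆ₙₐ[ℂ] (H →L[ℂ] H)), ‖b‖ ≤ ‖π b‖ := by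
  obtain ⟨H, i1, i2, i3, π, hπ⟩ := exists_rep_unital (b : Unitization ℂ B)
  refine ⟨H, i1, i2, i3, π.comp (Unitization.inrNonUnitalStarAlgHom ℂ B), ?_⟩
  rw [Unitization.norm_inr] at hπ
  exact hπ

section W
variable {G : Type} [Group G] {H : Type} [NormedAddCommGroup H] [InnerProductSpace ℂ H]

abbrev L2 (G H : Type) [NormedAddCommGroup H] := lp (fun _ : G => H) 2

/-- The weighted translation operator. -/
theorem exists_weighted (T : G → (H →L[ℂ] H)) (c : ℝ) (hT : ∀ k, ‖T k‖ ≤ c) (g : G) :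
    ∃ W : L2 G H →L[ℂ] L2 G H, ∀ ξ k, (W ξ : G → H) k = T k (ξ (k * g)) := by
  have hc : 0 ≤ c := (norm_nonneg _).trans (hT 1)
  have hsum : ∀ ξ : L2 G H, Summable fun k => ‖ξ (k * g)‖ ^ 2 := by
    intro ξ
    have h1 := (lp.memℓp ξ).summable (by norm_num)
    have h2 : Summable fun k => ‖ξ k‖ ^ 2 := by simpa using h1
    exact h2.comp_injective (i := fun k => k * g) (mul_left_injective g)
  have hle : ∀ (ξ : L2 G H) k, ‖T k (ξ (k * g))‖ ^ 2 ≤ c ^ 2 * ‖ξ (k * g)‖ ^ 2 := by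
    intro ξ k
    rw [← mul_pow]
    gcongr
    exact (T k).le_of_opNorm_le (hT k) _
  have hmem : ∀ ξ : L2 G H, Memℓp (fun k => T k (ξ (k * g))) 2 := by
    intro ξ
    apply memℓp_gen
    have : Summable fun k => ‖T k (ξ (k * g))‖ ^ 2 :=
      Summable.of_nonneg_of_le (fun _ => by positivity) (hle ξ) ((hsum ξ).mul_left _)
    simpa using this
  let W₀ : L2 G H →ₗ[ℂ] L2 G H :=
    { toFun := fun ξ => ⟨fun k => T k (ξ (k * g)), hmem ξ⟩
      map_add' := fun ξ η => by ext k; simp; rfl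
      map_smul' := fun a ξ => by ext k; simp }
  have hW₀ : ∀ ξ k, (W₀ ξ : G → H) k = T k (ξ (k * g)) := fun _ _ => rfl
  have hnorm : ∀ ξ : L2 G H, ‖ξ‖ ^ 2 = ∑' k, ‖ξ k‖ ^ 2 := by
    intro ξ
    have := lp.norm_rpow_eq_tsum (p := 2) (by norm_num) ξ
    simpa using this
  refine ⟨W₀.mkContinuous c ?_, fun ξ k => rfl⟩
  intro ξ
  rw [← sq_le_sq₀ (by positivity) (by positivity), mul_pow, hnorm, hnorm]
  have h3 : ∑' k, ‖ξ k‖ ^ 2 = ∑' k, ‖ξ (k * g)‖ ^ 2 :=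
    ((Equiv.mulRight g).tsum_eq (fun k => ‖ξ k‖ ^ 2)).symm
  rw [h3, ← tsum_mul_left]
  refine Summable.tsum_le_tsum (hle ξ) ?_ ((hsum ξ).mul_left _)
  exact Summable.of_nonneg_of_le (fun _ => by positivity) (hle ξ) ((hsum ξ).mul_left _)

end W

section Main
variable {G : Type} [Group G] {C : StarCatNu} {α : GAction G C} {CG : StarCatNu}

theorem ins_zero (h : IsCrossedProductAlg G C α CG) (g : G) (X Y : C.Obj) :
    h.ins g (0 : C.Hom X (α.actObj g⁻¹ Y)) = 0 := by
  have := h.ins_smul g X Y 0 0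
  simpa using this

theorem hom_induction (h : IsCrossedProductAlg G C α CG) {X Y : C.Obj}
    (P : CG.Hom (h.obj X) (h.obj Y) → Prop)
    (hins : ∀ g (f : C.Hom X (α.actObj g⁻¹ Y)), P (h.ins g f))
    (hadd : ∀ u v, P u → P v → P (u + v)) (u : CG.Hom (h.obj X) (h.obj Y)) : P u := by
  classical
  have h0 : P 0 := by
    rw [← ins_zero h 1]; exact hins _ _
  obtain ⟨s, φ, rfl⟩ := h.span X Y u
  induction s using Finset.induction_on with
  | empty => simpa using h0
  | insert a s ha ih =>
    rw [Finset.sum_insert ha]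
    exact hadd _ _ (hins _ _) ih

/-- Linear maps out of the morphism spaces are determined freely on the summands. -/
theorem exists_lift (h : IsCrossedProductAlg G C α CG) {M : Type} [AddCommGroup M] [Module ℂ M]
    (X Y : C.Obj) (W : ∀ g : G, C.Hom X (α.actObj g⁻¹ Y) →ₗ[ℂ] M) :
    ∃ Ψ : CG.Hom (h.obj X) (h.obj Y) →ₗ[ℂ] M, ∀ g f, Ψ (h.ins g f) = W g f := by
  classical
  let I : ∀ g : G, C.Hom X (α.actObj g⁻¹ Y) →ₗ[ℂ] CG.Hom (h.obj X) (h.obj Y) := fun g =>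
    { toFun := fun f => h.ins g f
      map_add' := h.ins_add g X Y
      map_smul' := h.ins_smul g X Y }
  let E : (Π₀ g : G, C.Hom X (α.actObj g⁻¹ Y)) →ₗ[ℂ] CG.Hom (h.obj X) (h.obj Y) :=
    DFinsupp.lsum ℕ I
  have hE : ∀ g f, E (DFinsupp.single g f) = h.ins g f := by
    intro g f
    simp only [E, DFinsupp.lsum_single]
    rfl
  have hinj : Function.Injective E := by
    rw [injective_iff_map_eq_zero]
    intro x hx
    have h1 : E x = x.support.sum fun g => h.ins g (x g) := by
      conv_lhs => rw [← DFinsupp.sum_single (f := x)]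
      rw [DFinsupp.sum, map_sum]
      exact Finset.sum_congr rfl fun g _ => hE g _
    rw [h1] at hx
    have h2 := h.indep X Y _ _ hx
    ext g
    by_cases hg : g ∈ x.support
    · simpa using h2 g hg
    · simpa using hg
  have hsurj : Function.Surjective E := by
    intro u
    obtain ⟨s, φ, rfl⟩ := h.span X Y u
    refine ⟨s.sum fun g => DFinsupp.single g (φ g), ?_⟩
    rw [map_sum]
    exact Finset.sum_congr rfl fun g _ => hE g _
  let e := LinearEquiv.ofBijective E ⟨hinj, hsurj⟩
  refine ⟨(DFinsupp.lsum ℕ W).comp e.symm.toLinearMap, fun g f => ?_⟩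
  have h3 : e.symm (h.ins g f) = DFinsupp.single g f := by
    rw [LinearEquiv.symm_apply_eq]
    exact (hE g f).symm
  show DFinsupp.lsum ℕ W (e.symm (h.ins g f)) = _
  rw [h3, DFinsupp.lsum_single]

theorem exists_lift_all (h : IsCrossedProductAlg G C α CG) {M : Type} [AddCommGroup M]
    [Module ℂ M] (W : ∀ (X Y : C.Obj) (g : G), C.Hom X (α.actObj g⁻¹ Y) →ₗ[ℂ] M) :
    ∃ Ψ : ∀ X' Y' : CG.Obj, CG.Hom X' Y' →ₗ[ℂ] M,
      ∀ X Y g f, Ψ (h.obj X) (h.obj Y) (h.ins g f) = W X Y g f := by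
  have key : ∀ X' Y' : CG.Obj, ∃ ψ : CG.Hom X' Y' →ₗ[ℂ] M,
      ∀ X Y (hX : h.obj X = X') (hY : h.obj Y = Y') g f,
        ψ (CG.castHom hX hY (h.ins g f)) = W X Y g f := by
    intro X' Y'
    obtain ⟨X, rfl⟩ := h.obj_bij.2 X'
    obtain ⟨Y, rfl⟩ := h.obj_bij.2 Y'
    obtain ⟨ψ, hψ⟩ := exists_lift h X Y (W X Y)
    refine ⟨ψ, ?_⟩
    intro X₂ Y₂ hX hY g f
    obtain rfl := h.obj_bij.1 hX
    obtain rfl := h.obj_bij.1 hY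
    exact hψ g f
  choose Ψ hΨ using key
  exact ⟨Ψ, fun X Y g f => hΨ _ _ X Y rfl rfl g f⟩

/-- The underlying map of a representation. -/
def rmap {B : Type} [NonUnitalCStarAlgebra B] (ρ : StarFunctor C (StarCatNu.ofAlgebra B))
    {X Y : C.Obj} (f : C.Hom X Y) : B := ρ.map f

theorem rmap_cast {B : Type} [NonUnitalCStarAlgebra B]
    (ρ : StarFunctor C (StarCatNu.ofAlgebra B))
    {X Y X' Y' : C.Obj} (hX : X = X') (hY : Y = Y') (f : C.Hom X Y) :
    rmap ρ (C.castHom hX hY f) = rmap ρ f := by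
  subst hX hY; rfl

theorem actMap_cast (α : GAction G C) (g : G) {X Y X' Y' : C.Obj} (hX : X = X') (hY : Y = Y')
    (f : C.Hom X Y) :
    α.actMap g (C.castHom hX hY f) =
      C.castHom (congrArg (α.actObj g) hX) (congrArg (α.actObj g) hY) (α.actMap g f) := by
  subst hX hY; rfl

theorem rmap_one {B : Type} [NonUnitalCStarAlgebra B]
    (ρ : StarFunctor C (StarCatNu.ofAlgebra B)) (α : GAction G C)
    {X Y : C.Obj} (f : C.Hom X Y) : rmap ρ (α.actMap 1 f) = rmap ρ f := by
  conv_rhs => rw [← α.one_map X Y f]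
  rw [rmap_cast]

theorem rmap_mul {B : Type} [NonUnitalCStarAlgebra B]
    (ρ : StarFunctor C (StarCatNu.ofAlgebra B)) (α : GAction G C) (g k : G)
    {X Y : C.Obj} (f : C.Hom X Y) :
    rmap ρ (α.actMap g (α.actMap k f)) = rmap ρ (α.actMap (g * k) f) := by
  rw [← α.mul_map g k X Y f, rmap_cast]

theorem rmap_act_congr {B : Type} [NonUnitalCStarAlgebra B]
    (ρ : StarFunctor C (StarCatNu.ofAlgebra B)) (α : GAction G C) {g k : G} (hgk : g = k)
    {X Y : C.Obj} (f : C.Hom X Y) :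
    rmap ρ (α.actMap g f) = rmap ρ (α.actMap k f) := by
  subst hgk; rfl

theorem castHom_heq {X Y X' Y' : C.Obj} (hX : X = X') (hY : Y = Y') (f : C.Hom X Y) :
    HEq (C.castHom hX hY f) f := by
  subst hX hY; rfl

theorem comp_heq {X Y Z X' Y' Z' : C.Obj} (hX : X = X') (hY : Y = Y') (hZ : Z = Z')
    {u : C.Hom Y Z} {v : C.Hom X Y} {u' : C.Hom Y' Z'} {v' : C.Hom X' Y'}
    (hu : HEq u u') (hv : HEq v v') : HEq (C.comp u v) (C.comp u' v') := by
  subst hX hY hZ hu hv; rfl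

theorem star_heq {X Y X' Y' : C.Obj} (hX : X = X') (hY : Y = Y')
    {u : C.Hom X Y} {u' : C.Hom X' Y'}
    (hu : HEq u u') : HEq (C.star u) (C.star u') := by
  subst hX hY hu; rfl

theorem act_heq (α : GAction G C) {g : G} (hg : g = 1) {X Y : C.Obj} (u : C.Hom X Y) :
    HEq (α.actMap g u) u := by
  subst hg
  have h1 := castHom_heq (α.one_obj X) (α.one_obj Y) (α.actMap 1 u)
  rw [α.one_map] at h1
  exact h1.symm

theorem ins_heq (h : IsCrossedProductAlg G C α CG) {g g' : G} (hg : g = g') {X Y : C.Obj}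
    {u : C.Hom X (α.actObj g⁻¹ Y)} {u' : C.Hom X (α.actObj g'⁻¹ Y)} (hu : HEq u u') :
    h.ins g u = h.ins g' u' := by
  subst hg hu; rfl

theorem nnnorm_rmap_le {B : Type} [NonUnitalCStarAlgebra B]
    (ρ : StarFunctor C (StarCatNu.ofAlgebra B)) {X Y : C.Obj} (f : C.Hom X Y) :
    (‖rmap ρ f‖₊ : ℝ≥0∞) ≤ C.maxNorm f :=
  le_sSup ⟨B, inferInstance, ρ, rfl⟩

theorem norm_rmap_act_le (hC : IsPreCStar C) {B : Type} [NonUnitalCStarAlgebra B]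
    (ρ : StarFunctor C (StarCatNu.ofAlgebra B)) (α : GAction G C) (k : G)
    {X Y : C.Obj} (f : C.Hom X Y) :
    ‖rmap ρ (α.actMap k f)‖ ≤ (C.maxNorm f).toReal := by
  have h1 := nnnorm_rmap_le ((α.functor k).comp ρ) f
  have h2 := ENNReal.toReal_mono (hC X Y f).ne h1
  exact h2

/-- The regular representation induced from a representation of `C`. -/
theorem exists_induced (hC : IsPreCStar C) (h : IsCrossedProductAlg G C α CG)
    {B : Type} [NonUnitalCStarAlgebra B] (ρ : StarFunctor C (StarCatNu.ofAlgebra B))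
    {X₀ Y₀ : C.Obj} (f₀ : C.Hom X₀ Y₀) :
    ∃ (B' : Type) (_ : NonUnitalCStarAlgebra B') (ρ' : StarFunctor CG (StarCatNu.ofAlgebra B')),
      ‖rmap ρ f₀‖ ≤ ‖rmap ρ' (h.ins 1 (C.castHom rfl (α.one_inv_obj Y₀).symm f₀))‖ := by
  classical
  obtain ⟨H, i1, i2, i3, π, hπ⟩ := exists_rep (rmap ρ f₀)
  have hbd : ∀ (X Y : C.Obj) (f : C.Hom X Y) (k : G),
      ‖π (rmap ρ (α.actMap k f))‖ ≤ (C.maxNorm f).toReal := fun X Y f k =>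
    (NonUnitalStarAlgHom.norm_apply_le π _).trans (norm_rmap_act_le hC ρ α k f)
  have hW : ∀ (X Y : C.Obj) (g : G) (f : C.Hom X (α.actObj g⁻¹ Y)),
      ∃ W : L2 G H →L[ℂ] L2 G H, ∀ ξ k,
        (W ξ : G → H) k = π (rmap ρ (α.actMap (k * g) f)) (ξ (k * g)) := fun X Y g f =>
    exists_weighted (fun k => π (rmap ρ (α.actMap (k * g) f))) _ (fun k => hbd _ _ f _) g
  choose W hW using hW
  have radd : ∀ (X Y : C.Obj) (u v : C.Hom X Y), rmap ρ (u + v) = rmap ρ u + rmap ρ v :=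
    ρ.map_add
  have rsmul : ∀ (X Y : C.Obj) (c : ℂ) (u : C.Hom X Y), rmap ρ (c • u) = c • rmap ρ u :=
    ρ.map_smul
  have rcomp : ∀ (X Y Z : C.Obj) (u : C.Hom Y Z) (v : C.Hom X Y),
      rmap ρ (C.comp u v) = rmap ρ u * rmap ρ v := ρ.map_comp
  have rstar : ∀ (X Y : C.Obj) (u : C.Hom X Y), rmap ρ (C.star u) = star (rmap ρ u) :=
    ρ.map_star
  let Wl : ∀ (X Y : C.Obj) (g : G), C.Hom X (α.actObj g⁻¹ Y) →ₗ[ℂ] (L2 G H →L[ℂ] L2 G H) :=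
    fun X Y g =>
    { toFun := W X Y g
      map_add' := fun u v => by
        ext ξ k
        rw [add_apply, lp.coeFn_add, Pi.add_apply, hW, hW, hW, α.map_add,
          radd, map_add, add_apply]
      map_smul' := fun c u => by
        ext ξ k
        rw [RingHom.id_apply, smul_apply, lp.coeFn_smul, Pi.smul_apply, hW,
          hW, α.map_smul, rsmul, map_smul, smul_apply] }
  obtain ⟨Ψ, hΨ⟩ := exists_lift_all h Wl
  replace hΨ : ∀ X Y g f, Ψ (h.obj X) (h.obj Y) (h.ins g f) = W X Y g f := hΨ
  have hcomp : ∀ (X' Y' Z' : CG.Obj) (u : CG.Hom Y' Z') (v : CG.Hom X' Y'),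
      Ψ _ _ (CG.comp u v) = Ψ _ _ u * Ψ _ _ v := by
    intro X' Y' Z'
    obtain ⟨X, rfl⟩ := h.obj_bij.2 X'
    obtain ⟨Y, rfl⟩ := h.obj_bij.2 Y'
    obtain ⟨Z, rfl⟩ := h.obj_bij.2 Z'
    intro u v
    induction u using hom_induction h with
    | hadd a b ha hb => rw [CG.add_comp, map_add, map_add, add_mul, ha, hb]
    | hins g' f' =>
      induction v using hom_induction h with
      | hadd a b ha hb => rw [CG.comp_add, map_add, map_add, mul_add, ha, hb]
      | hins g f =>
        rw [h.ins_comp, hΨ, hΨ, hΨ]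
        ext ξ k
        rw [mul_apply_eq_comp, hW, hW, hW, actMap_cast, rmap_cast, α.map_comp, rcomp,
          rmap_mul, map_mul, mul_apply_eq_comp]
        rw [rmap_act_congr ρ α (show k * (g' * g) * g⁻¹ = k * g' by group) f',
          rmap_act_congr ρ α (show k * (g' * g) = k * g' * g by group) f, ← mul_assoc]
  have hstar : ∀ (X' Y' : CG.Obj) (u : CG.Hom X' Y'),
      Ψ _ _ (CG.star u) = star (Ψ _ _ u) := by
    intro X' Y'
    obtain ⟨X, rfl⟩ := h.obj_bij.2 X'
    obtain ⟨Y, rfl⟩ := h.obj_bij.2 Y'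
    intro u
    induction u using hom_induction h with
    | hadd a b ha hb => rw [CG.star_add, map_add, map_add, star_add, ha, hb]
    | hins g f =>
      rw [h.ins_star, hΨ, hΨ, ContinuousLinearMap.star_eq_adjoint,
        ContinuousLinearMap.eq_adjoint_iff]
      intro η ξ
      rw [lp.inner_eq_tsum, lp.inner_eq_tsum, ← (Equiv.mulRight g).tsum_eq]
      apply tsum_congr
      intro k
      rw [hW, hW, actMap_cast, rmap_cast, rmap_mul, α.map_star, rstar, map_star,
        ContinuousLinearMap.star_eq_adjoint, ContinuousLinearMap.adjoint_inner_left]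
      rw [rmap_act_congr ρ α (show (Equiv.mulRight g) k * g⁻¹ * g = k * g by simp) f]
      simp
  let ρ' : StarFunctor CG (StarCatNu.ofAlgebra (L2 G H →L[ℂ] L2 G H)) :=
    { obj := fun _ => PUnit.unit
      map := fun {X Y} u => Ψ X Y u
      map_add := fun X Y u v => map_add (Ψ X Y) u v
      map_smul := fun X Y c u => map_smul (Ψ X Y) c u
      map_comp := hcomp
      map_star := hstar }
  refine ⟨L2 G H →L[ℂ] L2 G H, inferInstance, ρ', ?_⟩
  have hρ' : rmap ρ' (h.ins 1 (C.castHom rfl (α.one_inv_obj Y₀).symm f₀)) =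
      W X₀ Y₀ 1 (C.castHom rfl (α.one_inv_obj Y₀).symm f₀) := hΨ _ _ _ _
  rw [hρ']
  refine hπ.trans (ContinuousLinearMap.opNorm_le_bound _ (norm_nonneg _) fun v => ?_)
  have h1 := (W X₀ Y₀ 1 (C.castHom rfl (α.one_inv_obj Y₀).symm f₀)).le_opNorm
    (lp.single 2 (1 : G) v)
  rw [lp.norm_single (by norm_num)] at h1
  refine le_trans ?_ h1
  refine le_trans (le_of_eq ?_) (lp.norm_apply_le_norm (by norm_num) _ (1 : G))
  rw [hW, actMap_cast, rmap_cast]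
  rw [rmap_act_congr ρ α (mul_one 1), rmap_one]
  simp

/-- The canonical functor into the algebraic crossed product. -/
def insFunctor (h : IsCrossedProductAlg G C α CG) : StarFunctor C CG where
  obj := h.obj
  map := fun {X Y} u => h.ins 1 (C.castHom rfl (α.one_inv_obj Y).symm u)
  map_add := fun X Y u v => by
    have h1 : C.castHom rfl (α.one_inv_obj Y).symm (u + v) =
      C.castHom rfl (α.one_inv_obj Y).symm u + C.castHom rfl (α.one_inv_obj Y).symm v := by
      generalize (α.one_inv_obj Y).symm = hY
      generalize α.actObj (1 : G)⁻¹ Y = Y' at hY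
      subst hY; rfl
    rw [h1, h.ins_add]
  map_smul := fun X Y c u => by
    have h1 : C.castHom rfl (α.one_inv_obj Y).symm (c • u) =
      c • C.castHom rfl (α.one_inv_obj Y).symm u := by
      generalize (α.one_inv_obj Y).symm = hY
      generalize α.actObj (1 : G)⁻¹ Y = Y' at hY
      subst hY; rfl
    rw [h1, h.ins_smul]
  map_comp := fun X Y Z u v => by
    rw [h.ins_comp]
    apply ins_heq h (mul_one 1).symm
    refine (castHom_heq _ _ _).trans (HEq.trans ?_ (castHom_heq _ _ _).symm)
    refine comp_heq rfl (α.one_inv_obj Y).symm ?_ ?_ (castHom_heq _ _ _).symm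
    · rw [α.one_inv_obj, α.one_inv_obj]
    · exact ((act_heq α inv_one _).trans (castHom_heq _ _ _)).symm
  map_star := fun X Y u => by
    rw [h.ins_star]
    apply ins_heq h inv_one.symm
    refine (castHom_heq _ _ _).trans (HEq.trans ?_ (castHom_heq _ _ _).symm)
    refine HEq.trans ?_ (act_heq α rfl _).symm
    exact star_heq rfl (α.one_inv_obj Y).symm (castHom_heq _ _ _).symm

theorem maxNorm_ins (hC : IsPreCStar C) (h : IsCrossedProductAlg G C α CG)
    {X Y : C.Obj} (f : C.Hom X Y) :
    CG.maxNorm (h.ins 1 (C.castHom rfl (α.one_inv_obj Y).symm f)) = C.maxNorm f := by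
  apply le_antisymm
  · apply sSup_le
    rintro r ⟨B, i, ρ, rfl⟩
    exact nnnorm_rmap_le ((insFunctor h).comp ρ) f
  · apply sSup_le
    rintro r ⟨B, i, ρ, rfl⟩
    obtain ⟨B', i', ρ', hρ'⟩ := exists_induced hC h ρ f
    refine le_trans ?_ (nnnorm_rmap_le ρ' _)
    exact ENNReal.coe_le_coe.2 hρ'

end Main

end CrossedAux

/-- Let `C` be a possibly non-unital small C*-category with an action of
a group `G`.  Then the canonical functor `ι_C : C → C ⋊ G` (the identity on objects,
sending a morphism `f` to `(f, e)`, followed by the completion morphism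
`κ : C ⋊^alg G → C ⋊ G`) is isometric on all morphism spaces. -/
theorem canonical_functor_to_crossedProduct_isometric
    (G : Type) [Group G] (C : StarCatNu) (hC : IsCStar C) (α : GAction G C)
    (CG : StarCatNu) (h : IsCrossedProductAlg G C α CG)
    (CGc : StarCatNu) (κ : StarFunctor CG CGc) (hκ : IsCompletion CG CGc κ) :
    ∀ (X Y : C.Obj) (f : C.Hom X Y),
      CGc.maxNorm (κ.map (h.ins 1 (C.castHom rfl (α.one_inv_obj Y).symm f))) =
        C.maxNorm f := by
  intro X Y f
  rw [hκ.isometric]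
  exact CrossedAux.maxNorm_ins hC.1 h f
end
end
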